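/- arXiv:2605.02314 — 3 statements merged into one kernel-verified Lean document; each statement's English description precedes it below -/
import Mathlib

section
/- A symbolic matrix product P (of degree k ≥ 1, with ℓ variables) is positive semi-definite if and only if P is symmetric. That is: for every n ≥ 1 and every assignment of real n×n matrices to the variables, all complex eigenvalues of the evaluated product are real and nonnegative, if and only if k is even and some cyclic shift of the word P can be written as L·Lᵀ. -/
open Matrix

/-- Evaluation of the symbolic matrix product `P = X_{ι 0}^{τ 0} ⋯ X_{ι (k-1)}^{τ (k-1)}`
on an assignment `A` of real `n × n` matrices; exponent `false` is the matrix itself,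
`true` its transpose. -/
noncomputable def evalWord {k ℓ n : ℕ} (ι : Fin k → Fin ℓ) (τ : Fin k → Bool)
    (A : Fin ℓ → Matrix (Fin n) (Fin n) ℝ) : Matrix (Fin n) (Fin n) ℝ :=
  ((List.finRange k).map (fun i => if τ i then (A (ι i))ᵀ else A (ι i))).prod

/-- `P` is positive semi-definite: for every `n ≥ 1` and every assignment, every complex
eigenvalue (root of the characteristic polynomial, mapped into `ℂ`) is real and nonnegative. -/
def PositiveSemidefinite {k ℓ : ℕ} (ι : Fin k → Fin ℓ) (τ : Fin k → Bool) : Prop :=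
  ∀ n : ℕ, 1 ≤ n → ∀ A : Fin ℓ → Matrix (Fin n) (Fin n) ℝ, ∀ μ : ℂ,
    (Polynomial.map (algebraMap ℝ ℂ) (Matrix.charpoly (evalWord ι τ A))).IsRoot μ →
    μ.im = 0 ∧ 0 ≤ μ.re

/-- `P` is symmetric: `k` is even and some cyclic shift of the word can
be written as `L·Lᵀ`. -/
def SymmetricWord {k ℓ : ℕ} (hk : 0 < k) (ι : Fin k → Fin ℓ) (τ : Fin k → Bool) : Prop :=
  k % 2 = 0 ∧ ∃ j : ℕ, j < k ∧ ∀ s : ℕ, s < k / 2 →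
    ι ⟨(j + 1 + s) % k, Nat.mod_lt _ hk⟩ = ι ⟨(j + k - s) % k, Nat.mod_lt _ hk⟩ ∧
    τ ⟨(j + 1 + s) % k, Nat.mod_lt _ hk⟩ ≠ τ ⟨(j + k - s) % k, Nat.mod_lt _ hk⟩

section WeightedShift

variable {G R : Type*} [DecidableEq G] [AddMonoid G] [CommSemiring R]

/-- The matrix sending each index `a` to `a + s` with weight `φ a`. -/
def weightedShift (s : G) (φ : G → R) : Matrix G G R :=
  Matrix.of fun a b => if b = a + s then φ a else 0

theorem weightedShift_mul [Fintype G] (s t : G) (φ ψ : G → R) :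
    weightedShift s φ * weightedShift t ψ =
      weightedShift (s + t) fun a => φ a * ψ (a + s) := by
  ext a b
  rw [Matrix.mul_apply, Finset.sum_eq_single (a + s)]
  · simp [weightedShift, add_assoc]
  · intro j _ hj
    simp [weightedShift, hj]
  · simp

theorem weightedShift_list_prod [Fintype G] (s : G) (φ : ℕ → G → R) (m : ℕ) :
    ((List.range m).map fun i => weightedShift s (φ i)).prod =
      weightedShift (m • s) fun a => ∏ i ∈ Finset.range m, φ i (a + i • s) := by
  induction m with
  | zero =>
    ext a b
    simp [weightedShift, Matrix.one_apply, eq_comm]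
  | succ m ih =>
    rw [List.range_succ, List.map_append, List.prod_append, ih]
    simp [weightedShift_mul, succ_nsmul, Finset.prod_range_succ]

end WeightedShift

section LaurentExpansion

variable {M : Type*} [Semiring M]

/-- The coefficient of `z ^ d` in the product of the first `m` factors `z F i + z⁻¹ B i`. -/
def laurentCoeff (F B : ℕ → M) : ℕ → ℤ → M
  | 0, d => if d = 0 then 1 else 0
  | m + 1, d => laurentCoeff F B m (d - 1) * F m + laurentCoeff F B m (d + 1) * B m

theorem laurentCoeff_eq_zero (F B : ℕ → M) (m : ℕ) (d : ℤ) (h : (m : ℤ) < |d|) :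
    laurentCoeff F B m d = 0 := by
  induction m generalizing d with
  | zero =>
    have : d ≠ 0 := by rintro rfl; simp at h
    simp [laurentCoeff, this]
  | succ m ih =>
    rw [laurentCoeff, ih, ih] <;> grind

theorem laurentCoeff_self (F B : ℕ → M) (m : ℕ) :
    laurentCoeff F B m m = ((List.range m).map F).prod := by
  induction m with
  | zero => simp [laurentCoeff]
  | succ m ih =>
    rw [laurentCoeff, laurentCoeff_eq_zero F B m ((m + 1 : ℕ) + 1) (by grind)]
    simp [List.range_succ, ih]

theorem laurentCoeff_neg (F B : ℕ → M) (m : ℕ) :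
    laurentCoeff F B m (-m) = ((List.range m).map B).prod := by
  induction m with
  | zero => simp [laurentCoeff]
  | succ m ih =>
    rw [laurentCoeff, laurentCoeff_eq_zero F B m (-(m + 1 : ℕ) - 1) (by grind)]
    simp [List.range_succ, ih]

theorem hasSum_laurentCoeff {K : Type*} [Field K] [Algebra K M] [TopologicalSpace M]
    [IsTopologicalSemiring M] (F B : ℕ → M) (m : ℕ) {z : K} (hz : z ≠ 0) :
    HasSum (fun d : ℤ => z ^ d • laurentCoeff F B m d)
      ((List.range m).map fun i => z • F i + z⁻¹ • B i).prod := by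
  induction m with
  | zero =>
    convert hasSum_ite_eq (0 : ℤ) (1 : M) using 2 with d
    · by_cases h : d = 0 <;> simp [laurentCoeff, h]
    · simp
  | succ m ih =>
    have h1 := ((Equiv.subRight (1 : ℤ)).hasSum_iff.mpr ih).mul_right (z • F m)
    have h2 := ((Equiv.addRight (1 : ℤ)).hasSum_iff.mpr ih).mul_right (z⁻¹ • B m)
    rw [List.range_succ, List.map_append, List.prod_append]
    simp only [List.map_cons, List.map_nil, List.prod_cons, List.prod_nil, mul_one, mul_add]
    have hd (d : ℤ) : z ^ d • laurentCoeff F B (m + 1) d =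
        z ^ (d - 1) • laurentCoeff F B m (d - 1) * z • F m +
          z ^ (d + 1) • laurentCoeff F B m (d + 1) * z⁻¹ • B m := by
      rw [smul_mul_smul_comm, smul_mul_smul_comm, zpow_sub_one₀ hz, zpow_add_one₀ hz,
        inv_mul_cancel_right₀ hz, mul_inv_cancel_right₀ hz, laurentCoeff, smul_add]
    simp only [hd]
    exact h1.add h2

end LaurentExpansion

theorem laurentCoeff_weightedShift_apply {k : ℕ} [NeZero k] {R : Type*} [CommSemiring R]
    (φ ψ : ℕ → ZMod k → R) (m : ℕ) (d : ℤ) {a b : ZMod k} (h : b ≠ a + d) :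
    laurentCoeff (fun i => weightedShift 1 (φ i)) (fun i => weightedShift (-1) (ψ i)) m d a b
      = 0 := by
  induction m generalizing d a b with
  | zero =>
    rw [laurentCoeff]
    split_ifs with hd
    · subst hd
      exact Matrix.one_apply_ne fun hab => h (by simp [hab])
    · rfl
  | succ m ih =>
    rw [laurentCoeff, Matrix.add_apply, Matrix.mul_apply, Matrix.mul_apply,
      Finset.sum_eq_zero, Finset.sum_eq_zero, add_zero]
    · intro x _
      by_cases hx : x = a + (d + 1 : ℤ)
      · rw [weightedShift, Matrix.of_apply, if_neg, mul_zero]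
        rintro rfl
        exact h (by rw [hx]; push_cast; ring)
      · rw [ih _ hx, zero_mul]
    · intro x _
      by_cases hx : x = a + (d - 1 : ℤ)
      · rw [weightedShift, Matrix.of_apply, if_neg, mul_zero]
        rintro rfl
        exact h (by rw [hx]; push_cast; ring)
      · rw [ih _ hx, zero_mul]

/-- A closed walk of length `k` on the cycle `ZMod k` winds around `1`, `0` or `-1` times. -/
theorem trace_prod_weightedShift {k : ℕ} [NeZero k] (φ ψ : ℕ → ZMod k → ℂ) {z : ℂ}
    (hz : z ≠ 0) :
    (((List.range k).map fun i =>
      z • weightedShift 1 (φ i) + z⁻¹ • weightedShift (-1) (ψ i)).prod).trace =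
    z ^ k * ∑ a : ZMod k, ∏ i ∈ Finset.range k, φ i (a + i) +
    (laurentCoeff (fun i => weightedShift 1 (φ i)) (fun i => weightedShift (-1) (ψ i))
      k 0).trace +
    (z ^ k)⁻¹ * ∑ a : ZMod k, ∏ i ∈ Finset.range k, ψ i (a - i) := by
  have hk : (k : ℤ) ≠ 0 := by exact_mod_cast NeZero.ne k
  set F : ℕ → Matrix (ZMod k) (ZMod k) ℂ := fun i => weightedShift 1 (φ i) with hF
  set B : ℕ → Matrix (ZMod k) (ZMod k) ℂ := fun i => weightedShift (-1) (ψ i) with hB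
  have hs : HasSum (fun d : ℤ => z ^ d * (laurentCoeff F B k d).trace)
      (((List.range k).map fun i => z • F i + z⁻¹ • B i).prod).trace := by
    simpa [Matrix.trace_smul, Function.comp_def] using
      (hasSum_laurentCoeff F B k hz).map (Matrix.traceAddMonoidHom (ZMod k) ℂ)
        (continuous_id.matrix_trace)
  have h0 : ∀ d ∉ ({(k : ℤ), 0, -(k : ℤ)} : Finset ℤ),
      z ^ d * (laurentCoeff F B k d).trace = 0 := by
    intro d hd
    simp only [Finset.mem_insert, Finset.mem_singleton, not_or] at hd
    by_cases hlt : (k : ℤ) < |d|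
    · simp [laurentCoeff_eq_zero F B k d hlt]
    · have hdk : (d : ZMod k) ≠ 0 := by
        rw [Ne, ZMod.intCast_zmod_eq_zero_iff_dvd]
        intro hdvd
        have := Int.eq_zero_of_abs_lt_dvd hdvd (by grind)
        grind
      rw [Matrix.trace, Finset.sum_eq_zero, mul_zero]
      intro a _
      exact laurentCoeff_weightedShift_apply φ ψ k d (by simpa using hdk)
  have hF' : (laurentCoeff F B k k).trace = ∑ a : ZMod k, ∏ i ∈ Finset.range k, φ i (a + i) := by
    rw [laurentCoeff_self, hF, weightedShift_list_prod]
    simp [Matrix.trace, weightedShift]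
  have hB' : (laurentCoeff F B k (-k)).trace =
      ∑ a : ZMod k, ∏ i ∈ Finset.range k, ψ i (a - i) := by
    rw [laurentCoeff_neg, hB, weightedShift_list_prod]
    simp [Matrix.trace, weightedShift, sub_eq_add_neg]
  rw [hs.unique (hasSum_sum_of_ne_finset_zero h0), Finset.sum_insert (by simp; grind),
    Finset.sum_insert (by simp; grind), Finset.sum_singleton, hF', hB']
  simp [add_assoc]

section Realification

variable {n : Type*} [Fintype n] [DecidableEq n]

/-- The real matrix of the real-linear map underlying a complex matrix. -/
def realification : Matrix n n ℂ →* Matrix (n ⊕ n) (n ⊕ n) ℝ where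
  toFun C := Matrix.fromBlocks (C.map Complex.re) (-(C.map Complex.im)) (C.map Complex.im)
    (C.map Complex.re)
  map_one' := by
    rw [← Matrix.fromBlocks_one]
    congr 1 <;> ext i j <;> by_cases h : i = j <;> simp [Matrix.one_apply, h]
  map_mul' C D := by
    rw [Matrix.fromBlocks_multiply]
    congr 1
    all_goals
      ext i j
      simp only [Matrix.mul_apply, Matrix.map_apply, Matrix.add_apply, Matrix.neg_apply,
        Complex.re_sum, Complex.im_sum, Complex.mul_re, Complex.mul_im,
        ← Finset.sum_add_distrib, ← Finset.sum_neg_distrib]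
      exact Finset.sum_congr rfl fun _ _ => by ring

theorem realification_conjTranspose (C : Matrix n n ℂ) :
    realification Cᴴ = (realification C)ᵀ := by
  simp only [realification, MonoidHom.coe_mk, OneHom.coe_mk, Matrix.fromBlocks_transpose]
  congr 1
  all_goals
    ext i j
    simp

theorem isRoot_charpoly_iff (M : Matrix n n ℂ) (μ : ℂ) :
    M.charpoly.IsRoot μ ↔ ∃ v ≠ 0, M *ᵥ v = μ • v := by
  rw [Polynomial.IsRoot, Matrix.eval_charpoly, ← Matrix.exists_mulVec_eq_zero_iff]
  simp [Matrix.sub_mulVec, sub_eq_zero, eq_comm]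

theorem isRoot_charpoly_realification (C : Matrix n n ℂ) (μ : ℂ) (h : C.charpoly.IsRoot μ) :
    ((realification C).charpoly.map (algebraMap ℝ ℂ)).IsRoot μ := by
  obtain ⟨v, hv, hCv⟩ := (isRoot_charpoly_iff C μ).mp h
  rw [← Matrix.charpoly_map, isRoot_charpoly_iff]
  refine ⟨Sum.elim v (-Complex.I • v), fun h0 => hv ?_, ?_⟩
  · ext i
    exact congrFun h0 (Sum.inl i)
  · have hC : C.map (fun z => (z.re : ℂ)) *ᵥ v + Complex.I • (C.map (fun z => (z.im : ℂ)) *ᵥ v)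
        = μ • v := by
      rw [← hCv, ← Matrix.smul_mulVec, ← Matrix.add_mulVec]
      congr 1
      ext i j
      simp [mul_comm Complex.I, Complex.re_add_im]
    have hmap : (realification C).map (algebraMap ℝ ℂ) =
        Matrix.fromBlocks (C.map fun z => (z.re : ℂ)) (-(C.map fun z => (z.im : ℂ)))
          (C.map fun z => (z.im : ℂ)) (C.map fun z => (z.re : ℂ)) := by
      simp only [realification, MonoidHom.coe_mk, OneHom.coe_mk, Matrix.fromBlocks_map]
      congr 1
      ext i j
      simp
    rw [hmap, Matrix.fromBlocks_mulVec]
    ext (i | i)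
    · have := congrFun hC i
      simp [Matrix.neg_mulVec, Matrix.mulVec_smul, Matrix.mulVec_neg] at this ⊢
      rw [← this]
    · have := congrFun hC i
      simp [Matrix.neg_mulVec, Matrix.mulVec_smul, Matrix.mulVec_neg] at this ⊢
      linear_combination -Complex.I * this + (C.map (fun z => (z.im : ℂ)) *ᵥ v) i * Complex.I_sq

end Realification

section Cycle

variable {k : ℕ} [NeZero k]

/-- The function on the cycle `ZMod k` corresponding to a word indexed by `Fin k`. -/
def onCycle {α : Type*} (f : Fin k → α) (x : ZMod k) : α :=
  f ⟨x.val, x.val_lt⟩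

theorem onCycle_natCast {α : Type*} (f : Fin k → α) (i : ℕ) :
    onCycle f (i : ZMod k) = f ⟨i % k, Nat.mod_lt _ (NeZero.pos k)⟩ := by
  simp only [onCycle, ZMod.val_natCast]

theorem list_map_finRange_eq {α β γ : Type*} (f : Fin k → α) (g : Fin k → β)
    (F : α → β → γ) :
    (List.finRange k).map (fun i => F (f i) (g i)) =
      (List.range k).map fun i : ℕ => F (onCycle f i) (onCycle g i) := by
  rw [← List.map_coe_finRange_eq_range, List.map_map]
  refine List.map_congr_left fun i _ => ?_
  simp [onCycle_natCast, Nat.mod_eq_of_lt i.2]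

theorem evalWord_eq {ℓ n : ℕ} (ι : Fin k → Fin ℓ) (τ : Fin k → Bool)
    (A : Fin ℓ → Matrix (Fin n) (Fin n) ℝ) :
    evalWord ι τ A = ((List.range k).map fun i : ℕ =>
      if onCycle τ i then (A (onCycle ι i))ᵀ else A (onCycle ι i)).prod := by
  rw [evalWord, list_map_finRange_eq ι τ fun x t => if t then (A x)ᵀ else A x]

end Cycle

/-- For a positive semi-definite word, evaluation at complex matrices, with the conjugate
transpose in place of the transpose, has real trace. -/
theorem PositiveSemidefinite.trace_im_eq_zero {k ℓ : ℕ} {ι : Fin k → Fin ℓ}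
    {τ : Fin k → Bool} (h : PositiveSemidefinite ι τ) {n : Type*} [Fintype n] [DecidableEq n]
    [Nonempty n] (A : Fin ℓ → Matrix n n ℂ) :
    (((List.finRange k).map fun i =>
      if τ i then (A (ι i))ᴴ else A (ι i)).prod).trace.im = 0 := by
  set P := ((List.finRange k).map fun i => if τ i then (A (ι i))ᴴ else A (ι i)).prod with hP
  let e := Fintype.equivFin (n ⊕ n)
  have heval : evalWord ι τ (fun x => Matrix.reindexAlgEquiv ℝ ℝ e (realification (A x))) =
      Matrix.reindexAlgEquiv ℝ ℝ e (realification P) := by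
    rw [evalWord, hP, map_list_prod, map_list_prod, List.map_map, List.map_map]
    congr 1
    refine List.map_congr_left fun i _ => ?_
    cases hτ : τ i <;> simp [hτ, realification_conjTranspose]
  have hroot : ∀ μ ∈ P.charpoly.roots, μ.im = 0 := by
    intro μ hμ
    refine (h (Fintype.card (n ⊕ n)) Fintype.card_pos
      (fun x => Matrix.reindexAlgEquiv ℝ ℝ e (realification (A x))) μ ?_).1
    rw [heval, Matrix.coe_reindexAlgEquiv, Matrix.charpoly_reindex]
    exact isRoot_charpoly_realification P μ (Polynomial.isRoot_of_mem_roots hμ)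
  rw [Matrix.trace_eq_sum_roots_charpoly]
  change Complex.imAddGroupHom _ = 0
  rw [map_multiset_sum]
  refine Multiset.sum_eq_zero fun x hx => ?_
  obtain ⟨μ, hμ, rfl⟩ := Multiset.mem_map.mp hx
  exact hroot μ hμ

section Twist

variable {k ℓ : ℕ}

/-- The adjacency matrix of the `x`-labelled edges of the cycle spelling a word, twisted by `z`
on edges traversed forwards and by `z⁻¹` on edges traversed backwards. -/
noncomputable def twistedCycle (ι : ZMod k → Fin ℓ) (τ : ZMod k → Bool) (z : ℂ) (x : Fin ℓ) :
    Matrix (ZMod k) (ZMod k) ℂ :=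
  z • weightedShift 1 (fun a => if ι a = x ∧ τ a = false then 1 else 0) +
    z⁻¹ • weightedShift (-1) (fun a => if ι (a - 1) = x ∧ τ (a - 1) ≠ false then 1 else 0)

theorem ite_conjTranspose_twistedCycle (ι : ZMod k → Fin ℓ) (τ : ZMod k → Bool) {z : ℂ}
    (hz : ‖z‖ = 1) (x : Fin ℓ) (t : Bool) :
    (if t then (twistedCycle ι τ z x)ᴴ else twistedCycle ι τ z x) =
      z • weightedShift 1 (fun a => if ι a = x ∧ τ a = t then 1 else 0) +
      z⁻¹ • weightedShift (-1) (fun a => if ι (a - 1) = x ∧ τ (a - 1) ≠ t then 1 else 0) := by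
  cases t with
  | false => rfl
  | true =>
    have hz1 : (starRingEnd ℂ) z = z⁻¹ := (Complex.inv_eq_conj hz).symm
    ext a b
    have h1 : a = b + 1 ↔ b = a + -1 := by grind
    have h2 : a = b + -1 ↔ b = a + 1 := by grind
    simp only [twistedCycle, weightedShift, if_true, Matrix.conjTranspose_apply, Matrix.add_apply,
      Matrix.smul_apply, Matrix.of_apply, h1, h2]
    have h3 : (if b = a + -1 then (if ι b = x ∧ τ b = false then 1 else 0) else 0 : ℂ) =
        if b = a + -1 then (if ι (a - 1) = x ∧ τ (a - 1) ≠ true then 1 else 0) else 0 := by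
      grind
    have h4 : (if b = a + 1 then (if ι (b - 1) = x ∧ τ (b - 1) ≠ false then 1 else 0) else 0 : ℂ)
        = if b = a + 1 then (if ι a = x ∧ τ a = true then 1 else 0) else 0 := by
      grind
    rw [h3, h4, star_add, star_smul, star_smul, add_comm]
    split_ifs <;> simp [hz1]

/-- If a word is positive semi-definite, some reflection of the cycle preserves the
labels and reverses the exponents. -/
theorem exists_reflection [NeZero k] {ι : Fin k → Fin ℓ} {τ : Fin k → Bool}
    (h : PositiveSemidefinite ι τ) :
    ∃ c : ZMod k, ∀ x, onCycle ι (c - x) = onCycle ι x ∧ onCycle τ (c - x) ≠ onCycle τ x := by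
  set I := onCycle ι
  set T := onCycle τ
  let φ : ℕ → ZMod k → ℂ := fun i a => if I a = I i ∧ T a = T i then 1 else 0
  let ψ : ℕ → ZMod k → ℂ := fun i a => if I (a - 1) = I i ∧ T (a - 1) ≠ T i then 1 else 0
  let p : ZMod k → Prop := fun a => ∀ i ∈ Finset.range k, I (a + i) = I i ∧ T (a + i) = T i
  let q : ZMod k → Prop :=
    fun a => ∀ i ∈ Finset.range k, I (a - i - 1) = I i ∧ T (a - i - 1) ≠ T i
  classical
  obtain ⟨C, hC⟩ : ∃ C : ℂ, ∀ z : ℂ, ‖z‖ = 1 →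
      (z ^ k * (Finset.univ.filter p).card + C + (z ^ k)⁻¹ * (Finset.univ.filter q).card).im
        = 0 := by
    refine ⟨(laurentCoeff (fun i => weightedShift 1 (φ i)) (fun i => weightedShift (-1) (ψ i))
      k 0).trace, fun z hz => ?_⟩
    have hz0 : z ≠ 0 := by rintro rfl; simp at hz
    have htr := h.trace_im_eq_zero (twistedCycle I T z)
    rw [list_map_finRange_eq ι τ
      fun x t => if t then (twistedCycle I T z x)ᴴ else twistedCycle I T z x] at htr
    simp only [ite_conjTranspose_twistedCycle I T hz] at htr
    rw [trace_prod_weightedShift φ ψ hz0] at htr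
    have hφ : ∑ a : ZMod k, ∏ i ∈ Finset.range k, φ i (a + i) = (Finset.univ.filter p).card := by
      simp only [φ, Finset.prod_ite_zero, Finset.prod_const_one, Finset.sum_boole, p]
    have hψ : ∑ a : ZMod k, ∏ i ∈ Finset.range k, ψ i (a - i) = (Finset.univ.filter q).card := by
      simp only [ψ, Finset.prod_ite_zero, Finset.prod_const_one, Finset.sum_boole, q]
    rwa [hφ, hψ] at htr
  have hk : (k : ℂ) ≠ 0 := Nat.cast_ne_zero.mpr (NeZero.ne k)
  obtain ⟨z, hz, hzk⟩ : ∃ z : ℂ, ‖z‖ = 1 ∧ z ^ k = Complex.I := by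
    refine ⟨Complex.exp ((Real.pi / 2 / k : ℝ) * Complex.I), Complex.norm_exp_ofReal_mul_I _, ?_⟩
    rw [← Complex.exp_nat_mul]
    refine Eq.trans ?_ Complex.exp_pi_div_two_mul_I
    congr 1
    push_cast
    field_simp
  have h1 := hC z hz
  have h2 := hC z⁻¹ (by simp [hz])
  rw [inv_pow, hzk] at h2
  rw [hzk] at h1
  simp at h1 h2
  have hcard : (Finset.univ.filter q).card = (Finset.univ.filter p).card := by
    have : ((Finset.univ.filter q).card : ℝ) = (Finset.univ.filter p).card := by linarith
    exact_mod_cast this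
  have hp : (0 : ZMod k) ∈ Finset.univ.filter p := by simp [p]
  obtain ⟨a, ha⟩ := Finset.card_pos.mp (hcard ▸ Finset.card_pos.mpr ⟨0, hp⟩)
  refine ⟨a - 1, fun x => ?_⟩
  have := (Finset.mem_filter.mp ha).2 x.val (Finset.mem_range.mpr x.val_lt)
  rwa [ZMod.natCast_zmod_val, sub_right_comm] at this

end Twist

theorem symmetricWord_of_reflection {k ℓ : ℕ} [NeZero k] (hk : 0 < k) {ι : Fin k → Fin ℓ}
    {τ : Fin k → Bool} {c : ZMod k}
    (h : ∀ x, onCycle ι (c - x) = onCycle ι x ∧ onCycle τ (c - x) ≠ onCycle τ x) :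
    SymmetricWord hk ι τ := by
  have hodd : ∀ m : ℕ, ((2 * m : ℕ) : ZMod k) ≠ c := by
    rintro m rfl
    refine (h m).2 ?_
    congr 1
    push_cast
    ring
  have hc : ((c.val : ℕ) : ZMod k) = c := ZMod.natCast_zmod_val c
  have hlt : c.val < k := c.val_lt
  obtain ⟨j, hj⟩ : Odd c.val := by
    rw [← Nat.not_even_iff_odd]
    rintro ⟨m, hm⟩
    exact hodd m (by rw [← hc, hm, two_mul])
  have heven : k % 2 = 0 := by
    by_contra hk2
    obtain ⟨m, hm⟩ : Even (c.val + k) := by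
      rw [Nat.even_iff]
      omega
    refine hodd m ?_
    rw [two_mul, ← hm, Nat.cast_add, hc, ZMod.natCast_self, add_zero]
  refine ⟨heven, j, by omega, fun s hs => ?_⟩
  have hcs : c - (j + 1 + s : ℕ) = (j + k - s : ℕ) := by
    rw [← hc, hj, Nat.cast_sub (by omega)]
    push_cast
    rw [ZMod.natCast_self]
    ring
  have := h (j + 1 + s : ℕ)
  rw [hcs] at this
  simp only [onCycle_natCast] at this
  exact ⟨this.1.symm, this.2.symm⟩

section ProductOfWindow

variable {n : Type*} [Fintype n] [DecidableEq n]

theorem charpoly_prod_range_shift {R : Type*} [CommRing R] {k : ℕ} (g : ℕ → Matrix n n R)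
    (hg : Function.Periodic g k) (a : ℕ) :
    ((List.range k).map fun i => g (a + i)).prod.charpoly =
      ((List.range k).map g).prod.charpoly := by
  induction a with
  | zero => simp
  | succ a ih =>
    rw [← ih]
    cases k with
    | zero => simp
    | succ m =>
      rw [List.range_succ, List.map_append, List.prod_append, ← List.range_succ,
        List.range_succ_eq_map]
      simp only [List.map_cons, List.map_nil, List.prod_cons, List.prod_nil, mul_one,
        List.map_map, Function.comp_def]
      rw [Matrix.charpoly_mul_comm, show a + 1 + m = a + (m + 1) by ring, hg]
      simp [Nat.succ_eq_add_one, add_right_comm, add_assoc]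

theorem exists_prod_range_eq_mul_transpose {R : Type*} [CommRing R] (g : ℕ → Matrix n n R)
    (b h : ℕ) (hg : ∀ s < h, g (b + (2 * h - 1 - s)) = (g (b + s))ᵀ) :
    ∃ N, ((List.range (2 * h)).map fun i => g (b + i)).prod = N * Nᵀ := by
  induction h generalizing b with
  | zero => exact ⟨1, by simp⟩
  | succ h ih =>
    obtain ⟨N, hN⟩ := ih (b + 1) fun s hs => by
      convert hg (s + 1) (by omega) using 2
      · omega
      · rw [add_assoc, add_comm 1 s]
    refine ⟨g b * N, ?_⟩
    have hlast := hg 0 (by omega)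
    rw [show 2 * (h + 1) - 1 - 0 = 2 * h + 1 by omega, add_zero] at hlast
    rw [show 2 * (h + 1) = 2 * h + 1 + 1 by ring, List.range_succ, List.map_append,
      List.prod_append, List.range_succ_eq_map]
    simp only [List.map_cons, List.map_nil, List.prod_cons, List.prod_nil, mul_one,
      List.map_map, Function.comp_def, hlast, add_zero, Matrix.transpose_mul]
    simp only [Nat.succ_eq_add_one, add_assoc, add_comm 1] at hN ⊢
    rw [hN]
    simp only [mul_assoc]

theorem root_charpoly_mul_transpose (N : Matrix n n ℝ) {μ : ℂ}
    (hμ : ((N * Nᵀ).charpoly.map (algebraMap ℝ ℂ)).IsRoot μ) : μ.im = 0 ∧ 0 ≤ μ.re := by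
  have hN : (N * Nᵀ).PosSemidef := by
    simpa using Matrix.posSemidef_self_mul_conjTranspose N
  rw [hN.isHermitian.charpoly_eq, Polynomial.IsRoot, Polynomial.map_prod,
    Polynomial.eval_prod, Finset.prod_eq_zero_iff] at hμ
  obtain ⟨i, -, hi⟩ := hμ
  simp only [Polynomial.map_sub, Polynomial.map_X, Polynomial.map_C, Polynomial.eval_sub,
    Polynomial.eval_X, Polynomial.eval_C, sub_eq_zero] at hi
  rw [hi]
  simpa using hN.eigenvalues_nonneg i

end ProductOfWindow

theorem SymmetricWord.positiveSemidefinite {k ℓ : ℕ} {hk : 0 < k} {ι : Fin k → Fin ℓ}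
    {τ : Fin k → Bool} (h : SymmetricWord hk ι τ) : PositiveSemidefinite ι τ := by
  obtain ⟨heven, j, -, hj⟩ := h
  have : NeZero k := ⟨hk.ne'⟩
  intro n _ A μ hμ
  let g : ℕ → Matrix (Fin n) (Fin n) ℝ := fun i =>
    if onCycle τ i then (A (onCycle ι i))ᵀ else A (onCycle ι i)
  have hg : Function.Periodic g k := fun i => by simp [g]
  obtain ⟨N, hN⟩ := exists_prod_range_eq_mul_transpose g (j + 1) (k / 2) fun s hs => by
    have hjs := hj s hs
    simp only [← onCycle_natCast] at hjs
    rw [show j + 1 + (2 * (k / 2) - 1 - s) = j + k - s by omega]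
    simp only [g, hjs.1]
    cases h1 : onCycle τ (j + 1 + s : ℕ) <;> cases h2 : onCycle τ (j + k - s : ℕ) <;> simp_all
  rw [show 2 * (k / 2) = k by omega] at hN
  rw [evalWord_eq, ← charpoly_prod_range_shift g hg (j + 1), hN] at hμ
  exact root_charpoly_mul_transpose N hμ

/-- A symbolic matrix product is positive semi-definite if and only if it is symmetric. -/
theorem positiveSemidefinite_iff_symmetric {k ℓ : ℕ} (hk : 0 < k)
    (ι : Fin k → Fin ℓ) (τ : Fin k → Bool) :
    PositiveSemidefinite ι τ ↔ SymmetricWord hk ι τ := by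
  have : NeZero k := ⟨hk.ne'⟩
  exact ⟨fun h => (exists_reflection h).elim fun _ hc => symmetricWord_of_reflection hk hc,
    SymmetricWord.positiveSemidefinite⟩
end

section
/- Let P be a symbolic matrix product including symmetric variables, of degree k ≥ 1 with ℓ variables. Then P is real-eigenvalued (for every n ≥ 1 and every admissible assignment, all complex eigenvalues of the evaluated product are real) if and only if one of the following holds: (1) P is symmetric, i.e. k is even and some cyclic shift of the word equals L·Lᵀ for a word L of length k/2; or (2) k is odd and there exists a cyclic shift of the word of the form L·Lᵀ·X^sym, where L is a word of length (k−1)/2, Lᵀ is its formal-transpose reversal, and the last factor is a variable carrying the exponent sym. -/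
open Matrix

/-- The three possible exponents of a factor: the variable itself (`one`),
its transpose (`tr`), or a symmetric variable (`sym`). -/
inductive SymExp : Type
  | one : SymExp
  | tr : SymExp
  | sym : SymExp
  deriving DecidableEq

/-- The formal transpose of an exponent: flips `one ↔ tr` and fixes `sym`. -/
def SymExp.formalT : SymExp → SymExp
  | .one => .tr
  | .tr => .one
  | .sym => .sym

/-- Evaluation of the symbolic matrix product including symmetric variables:
the `i`-th factor is `A (ι i)` if `τ i ∈ {one, sym}` and `(A (ι i))ᵀ` if `τ i = tr`. -/
noncomputable def evalWordS {k ℓ n : ℕ} (ι : Fin k → Fin ℓ) (τ : Fin k → SymExp)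
    (A : Fin ℓ → Matrix (Fin n) (Fin n) ℝ) : Matrix (Fin n) (Fin n) ℝ :=
  ((List.finRange k).map (fun i => if τ i = SymExp.tr then (A (ι i))ᵀ else A (ι i))).prod

/-- `P` is real-eigenvalued: for every `n ≥ 1` and every admissible assignment
(the matrix assigned to a variable carrying exponent `sym` is symmetric), every complex
eigenvalue (root of the characteristic polynomial, mapped into `ℂ`) is real. -/
def RealEigenvaluedS {k ℓ : ℕ} (ι : Fin k → Fin ℓ) (τ : Fin k → SymExp) : Prop :=
  ∀ n : ℕ, 1 ≤ n → ∀ A : Fin ℓ → Matrix (Fin n) (Fin n) ℝ,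
    (∀ i : Fin k, τ i = SymExp.sym → (A (ι i))ᵀ = A (ι i)) →
    ∀ μ : ℂ,
      (Polynomial.map (algebraMap ℝ ℂ) (Matrix.charpoly (evalWordS ι τ A))).IsRoot μ →
      μ.im = 0

/-- `P` is symmetric: `k` is even and some cyclic shift of the word can be written as
`L·Lᵀ`, where `L` is a word of length `k/2` and `Lᵀ` its formal-transpose reversal. -/
def SymmetricWordS {k ℓ : ℕ} (hk : 0 < k) (ι : Fin k → Fin ℓ) (τ : Fin k → SymExp) : Prop :=
  k % 2 = 0 ∧ ∃ j : ℕ, j < k ∧ ∀ s : ℕ, s < k / 2 →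
    ι ⟨(j + 1 + s) % k, Nat.mod_lt _ hk⟩ = ι ⟨(j + k - s) % k, Nat.mod_lt _ hk⟩ ∧
    τ ⟨(j + 1 + s) % k, Nat.mod_lt _ hk⟩ =
      (τ ⟨(j + k - s) % k, Nat.mod_lt _ hk⟩).formalT

/-- `k` is odd and some cyclic shift of the word has the form `L·Lᵀ·X^sym`, where `L`
is a word of length `(k-1)/2` and the last factor carries the exponent `sym`. -/
def SymPlusVarWord {k ℓ : ℕ} (hk : 0 < k) (ι : Fin k → Fin ℓ) (τ : Fin k → SymExp) : Prop :=
  k % 2 = 1 ∧ ∃ j : ℕ, j < k ∧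
    (∀ s : ℕ, s < (k - 1) / 2 →
      ι ⟨(j + 1 + s) % k, Nat.mod_lt _ hk⟩ = ι ⟨(j + k - 1 - s) % k, Nat.mod_lt _ hk⟩ ∧
      τ ⟨(j + 1 + s) % k, Nat.mod_lt _ hk⟩ =
        (τ ⟨(j + k - 1 - s) % k, Nat.mod_lt _ hk⟩).formalT) ∧
    τ ⟨(j + k) % k, Nat.mod_lt _ hk⟩ = SymExp.sym

/-- A scalar is a root of the characteristic polynomial iff it has an eigenvector. -/
theorem Matrix.isRoot_charpoly_iff_exists_mulVec {α K : Type*} [Fintype α] [DecidableEq α] [Field K]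
    (M : Matrix α α K) (μ : K) :
    M.charpoly.IsRoot μ ↔ ∃ v, v ≠ 0 ∧ M *ᵥ v = μ • v := by
  rw [Polynomial.IsRoot, Matrix.eval_charpoly, ← Matrix.exists_mulVec_eq_zero_iff]
  refine exists_congr fun v => and_congr_right fun _ => ?_
  rw [Matrix.sub_mulVec, sub_eq_zero, Matrix.scalar_apply, ← Matrix.smul_one_eq_diagonal,
    Matrix.smul_mulVec, Matrix.one_mulVec, eq_comm]

theorem Matrix.IsHermitian.im_eq_zero_of_isRoot_map_charpoly {α : Type*} [Fintype α]
    [DecidableEq α] {N : Matrix α α ℝ} (hN : N.IsHermitian) {μ : ℂ}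
    (hμ : (N.charpoly.map (algebraMap ℝ ℂ)).IsRoot μ) : μ.im = 0 := by
  rw [hN.charpoly_eq, Polynomial.map_prod, Polynomial.IsRoot, Polynomial.eval_prod,
    Finset.prod_eq_zero_iff] at hμ
  obtain ⟨i, -, hi⟩ := hμ
  simp [sub_eq_zero] at hi
  simp [hi]

/-- The real matrix of size `2 * card α` underlying a complex matrix. -/
noncomputable def realify {α : Type*} {n : ℕ} (e : α ⊕ α ≃ Fin n) (M : Matrix α α ℂ) :
    Matrix (Fin n) (Fin n) ℝ :=
  Matrix.reindex e e (Matrix.fromBlocks (M.map Complex.re) (-M.map Complex.im)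
    (M.map Complex.im) (M.map Complex.re))

/-- The intertwiner between a complex matrix and the complexification of its realification. -/
noncomputable def realifyVec {α : Type*} {n : ℕ} (e : α ⊕ α ≃ Fin n) (v : α → ℂ) : Fin n → ℂ :=
  Sum.elim v (-Complex.I • v) ∘ e.symm

theorem realify_conjTranspose {α : Type*} {n : ℕ} (e : α ⊕ α ≃ Fin n) (M : Matrix α α ℂ) :
    realify e Mᴴ = (realify e M)ᵀ := by
  ext i j
  obtain ⟨i, rfl⟩ := e.surjective i
  obtain ⟨j, rfl⟩ := e.surjective j
  rcases i with i | i <;> rcases j with j | j <;> simp [realify]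

theorem realify_mulVec {α : Type*} [Fintype α] {n : ℕ} (e : α ⊕ α ≃ Fin n)
    (M : Matrix α α ℂ) (v : α → ℂ) :
    (realify e M).map (algebraMap ℝ ℂ) *ᵥ realifyVec e v = realifyVec e (M *ᵥ v) := by
  ext i
  obtain ⟨i, rfl⟩ := e.surjective i
  simp only [Matrix.mulVec, dotProduct, realifyVec, realify, ← e.sum_comp, Function.comp_apply,
    e.symm_apply_apply, Fintype.sum_sum_type, ← Finset.sum_add_distrib]
  rcases i with i | i
  · simp only [Sum.elim_inl, Matrix.map_apply, Matrix.reindex_apply, Matrix.submatrix_apply,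
      e.symm_apply_apply, Matrix.fromBlocks_apply₁₁, Matrix.fromBlocks_apply₁₂, Sum.elim_inr]
    refine Finset.sum_congr rfl fun j _ => ?_
    obtain ⟨a, b, hab⟩ : ∃ a b, M i j = ⟨a, b⟩ := ⟨_, _, rfl⟩
    simp [hab, Complex.mk_eq_add_mul_I]
    ring
  · simp only [Sum.elim_inl, Matrix.map_apply, Matrix.reindex_apply, Matrix.submatrix_apply,
      e.symm_apply_apply, Matrix.fromBlocks_apply₂₁, Matrix.fromBlocks_apply₂₂, Sum.elim_inr,
      Pi.smul_apply, smul_eq_mul, Matrix.mulVec, dotProduct, Finset.mul_sum]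
    refine Finset.sum_congr rfl fun j _ => ?_
    obtain ⟨a, b, hab⟩ : ∃ a b, M i j = ⟨a, b⟩ := ⟨_, _, rfl⟩
    simp [hab, Complex.mk_eq_add_mul_I]
    linear_combination ((b : ℂ) * v j) * Complex.I_mul_I

/-- The complex matrix of a letter, with the conjugate transpose playing the role of `T`. -/
noncomputable def complexLetter {α : Type*} {ℓ : ℕ} (A : Fin ℓ → Matrix α α ℂ)
    (p : Fin ℓ × SymExp) : Matrix α α ℂ :=
  if p.2 = SymExp.tr then (A p.1)ᴴ else A p.1

theorem RealEigenvaluedS.im_eq_zero_of_mulVec {k ℓ : ℕ} {ι : Fin k → Fin ℓ} {τ : Fin k → SymExp}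
    (h : RealEigenvaluedS ι τ) {α : Type*} [Fintype α] [DecidableEq α]
    (A : Fin ℓ → Matrix α α ℂ) (hA : ∀ i, τ i = SymExp.sym → (A (ι i))ᴴ = A (ι i))
    {v : α → ℂ} (hv : v ≠ 0) {μ : ℂ}
    (hμ : ((List.finRange k).map fun i => complexLetter A (ι i, τ i)).prod *ᵥ v = μ • v) :
    μ.im = 0 := by
  let e := Fintype.equivFin (α ⊕ α)
  obtain ⟨a, ha⟩ := Function.ne_iff.mp hv
  refine h _ (Fintype.card_pos_iff.mpr ⟨Sum.inl a⟩) (fun m => realify e (A m))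
    (fun i hi => by rw [← realify_conjTranspose, hA i hi]) μ ?_
  rw [← Matrix.charpoly_map, Matrix.isRoot_charpoly_iff_exists_mulVec]
  refine ⟨realifyVec e v, Function.ne_iff.mpr ⟨e (Sum.inl a), by simpa [realifyVec] using ha⟩, ?_⟩
  have key : ∀ (is : List (Fin k)) (v : α → ℂ),
      ((is.map fun i => if τ i = SymExp.tr then (realify e (A (ι i)))ᵀ
          else realify e (A (ι i))).prod.map (algebraMap ℝ ℂ)) *ᵥ realifyVec e v =
        realifyVec e ((is.map fun i => complexLetter A (ι i, τ i)).prod *ᵥ v) := by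
    intro is
    induction is with
    | nil => intro v; simp
    | cons i is ih =>
      intro v
      have hi : (if τ i = SymExp.tr then (realify e (A (ι i)))ᵀ else realify e (A (ι i))) =
          realify e (complexLetter A (ι i, τ i)) := by
        unfold complexLetter
        split_ifs
        · rw [realify_conjTranspose]
        · rfl
      rw [List.map_cons, List.prod_cons, List.map_cons, List.prod_cons, Matrix.map_mul,
        ← Matrix.mulVec_mulVec, ih, hi, realify_mulVec, Matrix.mulVec_mulVec]
  rw [evalWordS, key, hμ]
  ext i
  obtain ⟨i, rfl⟩ := e.surjective i
  rcases i with i | i <;> simp [realifyVec]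
  ring

/-- If all eigenvalues of `Q` are real, then so is the trace of `Q` on any invariant
coordinate subspace. -/
theorem im_sum_diag_eq_zero {α : Type*} [Fintype α] [DecidableEq α] (Q : Matrix α α ℂ)
    (hQ : ∀ v : α → ℂ, v ≠ 0 → ∀ μ : ℂ, Q *ᵥ v = μ • v → μ.im = 0) (T : Finset α)
    (hT : ∀ i ∉ T, ∀ j ∈ T, Q i j = 0) : (∑ i ∈ T, Q i i).im = 0 := by
  have htr : ∑ i ∈ T, Q i i = (Q.submatrix (Subtype.val : T → α) Subtype.val).trace := by
    rw [← Finset.sum_coe_sort]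
    rfl
  rw [htr, Matrix.trace_eq_sum_roots_charpoly]
  refine Multiset.sum_induction (fun z : ℂ => z.im = 0) _
    (fun a b ha hb => by simp [ha, hb]) rfl fun μ hμ => ?_
  obtain ⟨v, hv, hμv⟩ := (Matrix.isRoot_charpoly_iff_exists_mulVec _ _).mp
    (Polynomial.isRoot_of_mem_roots hμ)
  obtain ⟨a, ha⟩ := Function.ne_iff.mp hv
  refine hQ (fun i => if h : i ∈ T then v ⟨i, h⟩ else 0)
    (Function.ne_iff.mpr ⟨a, by simpa using ha⟩) μ ?_
  ext i
  have hsum : (Q *ᵥ fun i => if h : i ∈ T then v ⟨i, h⟩ else 0) i = ∑ j : T, Q i j * v j := by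
    rw [Matrix.mulVec, dotProduct, ← Finset.sum_subset (Finset.subset_univ T)
      fun j _ hj => by rw [dif_neg hj, mul_zero], ← Finset.sum_coe_sort]
    simp
  rw [hsum]
  by_cases hi : i ∈ T
  · simpa [hi, Matrix.mulVec, dotProduct] using congrFun hμv ⟨i, hi⟩
  · simpa [hi] using Finset.sum_eq_zero fun (j : T) _ => by rw [hT i hi j j.2, zero_mul]

section Walks

variable {k : ℕ} {β : Type*} [DecidableEq β]

/-- The number of walks on the cycle `ZMod k` from `x` to `y` with net displacement `n` reading
the given list of letters; edge `e`, from `e` to `e + 1`, reads `w e` upwards, and reads every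
`b` with `w e = T b` downwards. -/
def walkCount (w : ZMod k → β) (T : β → β) : List β → ZMod k → ZMod k → ℤ → ℕ
  | [], x, y, n => if x = y ∧ n = 0 then 1 else 0
  | b :: bs, x, y, n =>
      (if w x = b then walkCount w T bs (x + 1) y (n - 1) else 0) +
        if w (x - 1) = T b then walkCount w T bs (x - 1) y (n + 1) else 0

/-- The weighted adjacency matrix of a letter `b` on the cycle `ZMod k`. -/
noncomputable def stepMatrix (w : ZMod k → β) (T : β → β) (u : ℂ) (b : β) :
    Matrix (ZMod k) (ZMod k) ℂ :=
  fun x y => (if y = x + 1 ∧ w x = b then u else 0) +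
    if y = x - 1 ∧ w (x - 1) = T b then u⁻¹ else 0

theorem walkCount_support (w : ZMod k → β) (T : β → β) (bs : List β) (x y : ZMod k) (n : ℤ)
    (h : walkCount w T bs x y n ≠ 0) :
    |n| ≤ bs.length ∧ y = x + n ∧ Even (n + bs.length) := by
  induction bs generalizing x y n with
  | nil =>
    simp only [walkCount, ne_eq, ite_eq_right_iff, one_ne_zero, imp_false, not_not] at h
    simp [h.1, h.2]
  | cons b bs ih =>
    have h' : walkCount w T bs (x + 1) y (n - 1) ≠ 0 ∨ walkCount w T bs (x - 1) y (n + 1) ≠ 0 := by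
      by_contra! hc
      simp [walkCount, hc.1, hc.2] at h
    rcases h' with h' | h'
    all_goals
      obtain ⟨h1, h2, h3⟩ := ih _ _ _ h'
      rw [abs_le] at h1 ⊢
      refine ⟨by push_cast [List.length_cons]; omega, by rw [h2]; push_cast; ring, ?_⟩
      rw [Int.even_iff] at h3 ⊢
      push_cast [List.length_cons]
      omega

theorem walkCount_length_pos (w : ZMod k → β) (T : β → β) (f : ℕ → β) (m : ℕ) (x : ZMod k)
    (h : ∀ j < m, w (x + j) = f j) :
    0 < walkCount w T ((List.range m).map f) x (x + m) m := by
  induction m generalizing x f with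
  | zero => simp [walkCount]
  | succ m ih =>
    have := ih (f ∘ Nat.succ) (x + 1) fun j hj => by
      rw [Function.comp_apply, ← h (j + 1) (by omega)]
      push_cast
      ring_nf
    have h0 := h 0 (by omega)
    rw [Nat.cast_zero, add_zero] at h0
    rw [List.range_succ_eq_map, List.map_cons, List.map_map, walkCount, if_pos h0]
    push_cast
    rw [add_sub_cancel_right, show x + ((m : ZMod k) + 1) = x + 1 + m by ring]
    omega

theorem eq_of_walkCount_neg_length_ne_zero (w : ZMod k → β) (T : β → β) (f : ℕ → β) (m : ℕ)
    (x y : ZMod k) (h : walkCount w T ((List.range m).map f) x y (-m) ≠ 0) :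
    ∀ j < m, w (x - 1 - j) = T (f j) := by
  induction m generalizing x f with
  | zero => simp
  | succ m ih =>
    rw [List.range_succ_eq_map, List.map_cons, List.map_map, walkCount] at h
    have hup : walkCount w T ((List.range m).map (f ∘ Nat.succ)) (x + 1) y
        (-(m + 1 : ℕ) - 1) = 0 := by
      by_contra hc
      have := (walkCount_support _ _ _ _ _ _ hc).1
      rw [abs_le] at this
      simp at this
    simp only [hup, ite_self, zero_add, ne_eq, ite_eq_right_iff, Classical.not_imp] at h
    rw [show (-(m + 1 : ℕ) + 1 : ℤ) = -m by push_cast; ring] at h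
    intro j hj
    rcases j with _ | j
    · simpa using h.1
    · have := ih _ _ h.2 j (by omega)
      rw [Function.comp_apply] at this
      rw [← this]
      push_cast
      ring_nf

theorem hasSum_walkCount [NeZero k] (w : ZMod k → β) (T : β → β) {u : ℂ} (hu : u ≠ 0)
    (bs : List β) (x y : ZMod k) :
    HasSum (fun n : ℤ => (walkCount w T bs x y n : ℂ) * u ^ n)
      ((bs.map (stepMatrix w T u)).prod x y) := by
  induction bs generalizing x with
  | nil =>
    have := hasSum_single (f := fun n : ℤ => (walkCount w T [] x y n : ℂ) * u ^ n) 0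
      fun n hn => by simp [walkCount, hn]
    simpa [walkCount, Matrix.one_apply] using this
  | cons b bs ih =>
    have hup := ((Equiv.subRight (1 : ℤ)).hasSum_iff.mpr (ih (x + 1))).mul_left
      (if w x = b then u else 0)
    have hdown := ((Equiv.addRight (1 : ℤ)).hasSum_iff.mpr (ih (x - 1))).mul_left
      (if w (x - 1) = T b then u⁻¹ else 0)
    have hval : ((b :: bs).map (stepMatrix w T u)).prod x y =
        (if w x = b then u else 0) * (bs.map (stepMatrix w T u)).prod (x + 1) y +
          (if w (x - 1) = T b then u⁻¹ else 0) * (bs.map (stepMatrix w T u)).prod (x - 1) y := by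
      simp only [List.map_cons, List.prod_cons, Matrix.mul_apply, stepMatrix, add_mul,
        Finset.sum_add_distrib, ite_and, ite_mul, zero_mul, Finset.sum_ite_eq', Finset.mem_univ,
        if_true]
    rw [hval]
    refine (hup.add hdown).congr_fun fun n => ?_
    simp only [walkCount, Function.comp_apply, Equiv.subRight_apply, Equiv.coe_addRight,
      zpow_sub_one₀ hu, zpow_add_one₀ hu]
    split_ifs <;> push_cast <;> field_simp <;> simp

/-- The full-turn walks determine the imaginary part of a closed walk generating function when the
total flux is `I`. -/
theorem im_prod_stepMatrix_diag [NeZero k] (w : ZMod k → β) (T : β → β) {u : ℂ} (hu : u ≠ 0)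
    (huk : u ^ k = Complex.I) (bs : List β) (hbs : bs.length = k) (x : ZMod k) :
    ((bs.map (stepMatrix w T u)).prod x x).im =
      (walkCount w T bs x x k : ℝ) - walkCount w T bs x x (-k) := by
  have hk : (0 : ℤ) < k := by exact_mod_cast NeZero.pos k
  have h := Complex.hasSum_im (hasSum_walkCount w T hu bs x x)
  rw [h.unique (hasSum_sum_of_ne_finset_zero (s := ({(k : ℤ), -(k : ℤ)} : Finset ℤ)) fun n hn => ?_),
    Finset.sum_pair (by omega)]
  · simp [huk]
    ring
  · by_cases hc : walkCount w T bs x x n = 0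
    · simp [hc]
    obtain ⟨h1, h2, -⟩ := walkCount_support _ _ _ _ _ _ hc
    obtain ⟨c, rfl⟩ := (ZMod.intCast_zmod_eq_zero_iff_dvd n k).mp (by simpa using h2)
    rw [hbs, abs_le] at h1
    have hc0 : c = 0 := by
      simp only [Finset.mem_insert, Finset.mem_singleton, not_or] at hn
      have h3 : c ≤ 1 := by nlinarith
      have h4 : -1 ≤ c := by nlinarith
      have h5 : c ≠ 1 := by rintro rfl; simp at hn
      have h6 : c ≠ -1 := by rintro rfl; simp at hn
      omega
    simp [hc0]

theorem even_iff_of_prod_stepMatrix_ne_zero [NeZero k] (w : ZMod k → β) (T : β → β) {u : ℂ}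
    (hu : u ≠ 0) (bs : List β) (hbs : bs.length = k) (x y : ZMod k)
    (h : (bs.map (stepMatrix w T u)).prod x y ≠ 0) (hy : Even y) : Even x := by
  have : ∃ n, walkCount w T bs x y n ≠ 0 := by
    by_contra! hc
    refine h ((hasSum_walkCount w T hu bs x y).unique ?_)
    simp [hc, hasSum_zero]
  obtain ⟨n, hn⟩ := this
  obtain ⟨-, h2, c, hc⟩ := walkCount_support _ _ _ _ _ _ hn
  obtain ⟨d, rfl⟩ := hy
  have : (n : ZMod k) = c + c := by
    have := congrArg (Int.cast : ℤ → ZMod k) hc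
    simpa [hbs] using this
  exact ⟨d - c, by linear_combination -h2 - this⟩

/-- If the eigenvalues of the full turn around the cycle are real, the cyclic word `w` has a
reflection symmetry through a gap. -/
theorem exists_reflection_of_stepMatrix [NeZero k] (w : ZMod k → β) (T : β → β) {u : ℂ}
    (hu : u ≠ 0) (huk : u ^ k = Complex.I)
    (hQ : ∀ v : ZMod k → ℂ, v ≠ 0 → ∀ μ : ℂ,
      (((List.range k).map fun j : ℕ => w j).map (stepMatrix w T u)).prod *ᵥ v = μ • v →
        μ.im = 0) :
    ∃ y : ZMod k, ∀ s, w (y - 1 - s) = T (w (y + s)) := by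
  classical
  set bs := (List.range k).map fun j : ℕ => w j with hbs_def
  have hbs : bs.length = k := by simp [hbs_def]
  have him := im_sum_diag_eq_zero _ hQ {x | Even x} fun x hx y hy => by
    by_contra hne
    simp only [Finset.mem_filter, Finset.mem_univ, true_and] at hx hy
    exact hx (even_iff_of_prod_stepMatrix_ne_zero w T hu bs hbs x y hne hy)
  rw [Complex.im_sum] at him
  simp only [im_prod_stepMatrix_diag w T hu huk bs hbs, Finset.sum_sub_distrib] at him
  have hpos : 0 < walkCount w T bs 0 0 k := by
    simpa using walkCount_length_pos w T (fun j : ℕ => w j) k 0 (by simp)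
  have hsum : 0 < ∑ x : ZMod k with Even x, (walkCount w T bs x x k : ℝ) :=
    Finset.sum_pos' (fun _ _ => Nat.cast_nonneg _) ⟨0, by simp, by exact_mod_cast hpos⟩
  obtain ⟨x, hx, hne⟩ := Finset.exists_ne_zero_of_sum_ne_zero (by linarith :
    ∑ x : ZMod k with Even x, (walkCount w T bs x x (-k) : ℝ) ≠ 0)
  obtain ⟨y, rfl⟩ := (Finset.mem_filter.mp hx).2
  refine ⟨y, fun s => ?_⟩
  have := eq_of_walkCount_neg_length_ne_zero w T (fun j : ℕ => w j) k _ _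
    (by exact_mod_cast hne) (y + s).val (ZMod.val_lt _)
  rw [ZMod.natCast_zmod_val] at this
  rw [← this]
  ring_nf

end Walks

theorem SymExp.formalT_formalT (t : SymExp) : t.formalT.formalT = t := by
  cases t <;> rfl

/-- The formal transpose of a letter. -/
def letterT {ℓ : ℕ} : Fin ℓ × SymExp → Fin ℓ × SymExp :=
  Prod.map id SymExp.formalT

theorem letterT_letterT {ℓ : ℕ} (p : Fin ℓ × SymExp) : letterT (letterT p) = p :=
  Prod.ext rfl (SymExp.formalT_formalT _)

theorem snd_eq_sym_of_eq_letterT {ℓ : ℕ} {p : Fin ℓ × SymExp} (h : p = letterT p) :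
    p.2 = SymExp.sym := by
  obtain ⟨m, t⟩ := p
  cases t <;> simp_all [letterT, SymExp.formalT]

theorem eq_letterT_of_snd_eq_sym {ℓ : ℕ} {p : Fin ℓ × SymExp} (h : p.2 = SymExp.sym) :
    p = letterT p := by
  obtain ⟨m, t⟩ := p
  cases t <;> simp_all [letterT, SymExp.formalT]

theorem natCast_add_card_sub {k : ℕ} (j s : ℕ) (hs : s ≤ k) :
    ((j + k - s : ℕ) : ZMod k) = j - s := by
  rw [Nat.cast_sub (by omega)]
  simp

section CyclicWord

variable {k ℓ : ℕ} [NeZero k] (ι : Fin k → Fin ℓ) (τ : Fin k → SymExp)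

/-- The word as a function on the cycle `ZMod k`. -/
def cyclicWord (e : ZMod k) : Fin ℓ × SymExp :=
  (ι ⟨e.val, ZMod.val_lt e⟩, τ ⟨e.val, ZMod.val_lt e⟩)

theorem cyclicWord_natCast (a : ℕ) :
    cyclicWord ι τ a = (ι ⟨a % k, Nat.mod_lt _ (NeZero.pos k)⟩,
      τ ⟨a % k, Nat.mod_lt _ (NeZero.pos k)⟩) := by
  simp only [cyclicWord, ZMod.val_natCast]

theorem map_finRange_eq_map_range {γ : Type*} (f : Fin ℓ × SymExp → γ) :
    ((List.finRange k).map fun i => f (ι i, τ i)) =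
      (List.range k).map fun j : ℕ => f (cyclicWord ι τ j) := by
  rw [← List.map_coe_finRange_eq_range, List.map_map]
  refine List.map_congr_left fun i _ => ?_
  simp [cyclicWord_natCast, Nat.mod_eq_of_lt i.isLt]

theorem cyclicWord_eq_letterT_iff (a b : ℕ) :
    cyclicWord ι τ a = letterT (cyclicWord ι τ b) ↔
      ι ⟨a % k, Nat.mod_lt _ (NeZero.pos k)⟩ = ι ⟨b % k, Nat.mod_lt _ (NeZero.pos k)⟩ ∧
      τ ⟨a % k, Nat.mod_lt _ (NeZero.pos k)⟩ =
        (τ ⟨b % k, Nat.mod_lt _ (NeZero.pos k)⟩).formalT := by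
  rw [cyclicWord_natCast, cyclicWord_natCast, letterT, Prod.map_apply, Prod.mk.injEq, id]

/-- Both combinatorial conditions say that the cyclic word has a reflection symmetry whose axis
passes through the gap between two consecutive letters. -/
theorem symmetric_or_symPlusVar_iff_exists_reflection (hk : 0 < k) :
    SymmetricWordS hk ι τ ∨ SymPlusVarWord hk ι τ ↔
      ∃ y : ZMod k, ∀ s, cyclicWord ι τ (y - 1 - s) = letterT (cyclicWord ι τ (y + s)) := by
  have hk0 : (k : ZMod k) = 0 := ZMod.natCast_self k
  constructor
  · rintro (⟨heven, j, -, h⟩ | ⟨hodd, j, -, h, hsym⟩)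
    · have h' : ∀ s < k / 2,
          cyclicWord ι τ (j + 1 + s) = letterT (cyclicWord ι τ (j - s)) := fun s hs => by
        have := (cyclicWord_eq_letterT_iff ι τ _ _).mpr (h s hs)
        rw [natCast_add_card_sub j s (by omega)] at this
        exact_mod_cast this
      refine ⟨j + 1, fun s => ?_⟩
      obtain ⟨n, hn, rfl⟩ : ∃ n < k, (n : ZMod k) = s :=
        ⟨s.val, ZMod.val_lt s, ZMod.natCast_zmod_val s⟩
      by_cases hnk : n < k / 2
      · rw [h' n hnk, letterT_letterT]
        ring_nf
      · obtain ⟨m, hm⟩ : ∃ m, k = n + m + 1 := ⟨k - 1 - n, by omega⟩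
        have hm0 : (n : ZMod k) + m + 1 = 0 := by rw [← hk0]; exact_mod_cast congrArg _ hm.symm
        have := h' m (by omega)
        rwa [show (j + 1 + m : ZMod k) = j + 1 - 1 - n by linear_combination hm0,
          show (j - m : ZMod k) = j + 1 + n by linear_combination -hm0] at this
    · obtain ⟨d, hd⟩ : ∃ d, k = 2 * d + 1 := ⟨k / 2, by omega⟩
      have hd0 : 2 * (d : ZMod k) + 1 = 0 := by rw [← hk0]; exact_mod_cast congrArg _ hd.symm
      have h' : ∀ s < d,
          cyclicWord ι τ (j + 1 + s) = letterT (cyclicWord ι τ (j - 1 - s)) := fun s hs => by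
        have := (cyclicWord_eq_letterT_iff ι τ _ _).mpr (h s (by omega))
        rw [Nat.sub_sub, natCast_add_card_sub j (1 + s) (by omega)] at this
        push_cast at this
        rwa [← sub_sub] at this
      have hj : cyclicWord ι τ j = letterT (cyclicWord ι τ j) :=
        eq_letterT_of_snd_eq_sym (by rw [cyclicWord_natCast]; simpa using hsym)
      refine ⟨j - d, fun s => ?_⟩
      obtain ⟨n, hn, rfl⟩ : ∃ n < k, (n : ZMod k) = s :=
        ⟨s.val, ZMod.val_lt s, ZMod.natCast_zmod_val s⟩
      rcases lt_trichotomy n d with hnd | rfl | hnd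
      · obtain ⟨m, rfl⟩ : ∃ m, d = n + m + 1 := ⟨d - 1 - n, by omega⟩
        push_cast at hd0 ⊢
        have := h' m (by omega)
        rwa [show (j + 1 + m : ZMod k) = j - (n + m + 1) - 1 - n by linear_combination hd0,
          show (j - 1 - m : ZMod k) = j - (n + m + 1) + n by ring] at this
      · rwa [show (j - n - 1 - n : ZMod k) = j by linear_combination -hd0, sub_add_cancel]
      · obtain ⟨m, rfl⟩ : ∃ m, n = d + m + 1 := ⟨n - d - 1, by omega⟩
        push_cast
        have := h' m (by omega)
        rw [show (j - d + (d + m + 1) : ZMod k) = j + 1 + m by ring, this, letterT_letterT]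
        congr 1
        linear_combination -hd0
  · rintro ⟨y, h⟩
    rcases Nat.even_or_odd' k with ⟨d, hd | hd⟩
    · refine Or.inl ⟨by omega, (y - 1).val, ZMod.val_lt _, fun s hs => ?_⟩
      rw [← cyclicWord_eq_letterT_iff, natCast_add_card_sub _ s (by omega)]
      push_cast
      rw [ZMod.natCast_zmod_val]
      have := h (-1 - s)
      rwa [show y - 1 - (-1 - s : ZMod k) = y - 1 + 1 + s by ring,
        show y + (-1 - s : ZMod k) = y - 1 - s by ring] at this
    · have hd0 : 2 * (d : ZMod k) + 1 = 0 := by rw [← hk0]; exact_mod_cast congrArg _ hd.symm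
      refine Or.inr ⟨by omega, (y + d).val, ZMod.val_lt _, fun s hs => ?_, ?_⟩
      · rw [← cyclicWord_eq_letterT_iff, Nat.sub_sub, natCast_add_card_sub _ (1 + s) (by omega)]
        push_cast
        rw [ZMod.natCast_zmod_val]
        have := h (d - 1 - s)
        rwa [show y - 1 - (d - 1 - s : ZMod k) = y + d + 1 + s by linear_combination -hd0,
          show y + (d - 1 - s : ZMod k) = y + d - (1 + s) by ring] at this
      · have := h d
        rw [show y - 1 - d = y + d by linear_combination -hd0] at this
        have hsym := snd_eq_sym_of_eq_letterT this
        simpa [cyclicWord, Nat.mod_eq_of_lt (ZMod.val_lt _)] using hsym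

end CyclicWord

section Sufficiency

theorem charpoly_prod_map_range_add {α R : Type*} [Fintype α] [DecidableEq α] [CommRing R] {k : ℕ}
    (f : ℕ → Matrix α α R) (hf : ∀ j, f (j + k) = f j) (a : ℕ) :
    ((List.range k).map fun j => f (a + j)).prod.charpoly =
      ((List.range k).map f).prod.charpoly := by
  induction a with
  | zero => simp
  | succ a ih =>
    rw [← ih]
    rcases k with _ | k
    · rfl
    · conv_lhs => rw [List.range_succ, List.map_append, List.prod_append, List.map_singleton,
        List.prod_singleton, Matrix.charpoly_mul_comm,
        show a + 1 + k = a + (k + 1) by ring, hf]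
      conv_rhs => rw [List.range_succ_eq_map, List.map_cons, List.prod_cons, List.map_map]
      simp [Function.comp_def, Nat.add_right_comm, Nat.add_assoc]

/-- The real matrix of a letter. -/
noncomputable def realLetter {ℓ n : ℕ} (A : Fin ℓ → Matrix (Fin n) (Fin n) ℝ)
    (p : Fin ℓ × SymExp) : Matrix (Fin n) (Fin n) ℝ :=
  if p.2 = SymExp.tr then (A p.1)ᵀ else A p.1

theorem realLetter_letterT {ℓ n : ℕ} (A : Fin ℓ → Matrix (Fin n) (Fin n) ℝ)
    {p : Fin ℓ × SymExp} (hp : p.2 = SymExp.sym → (A p.1)ᵀ = A p.1) :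
    realLetter A (letterT p) = (realLetter A p)ᵀ := by
  obtain ⟨m, t⟩ := p
  cases t <;> simp_all [realLetter, letterT, SymExp.formalT]

theorem isSymm_prod_map_range {α R : Type*} [Fintype α] [DecidableEq α] [CommRing R] {k : ℕ}
    (f : ℕ → Matrix α α R) (hf : ∀ j < k, (f j)ᵀ = f (k - 1 - j)) :
    ((List.range k).map f).prod.IsSymm := by
  rw [Matrix.IsSymm, Matrix.transpose_list_prod]
  congr 1
  refine List.ext_getElem (by simp) fun j hj _ => ?_
  simp only [List.length_reverse, List.length_map, List.length_range] at hj
  simp only [List.getElem_reverse, List.getElem_map, List.getElem_range, List.length_map,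
    List.length_range]
  rw [hf _ (by omega)]
  congr 1
  omega

theorem realEigenvaluedS_of_reflection {k ℓ : ℕ} [NeZero k] (ι : Fin k → Fin ℓ)
    (τ : Fin k → SymExp) (y : ZMod k)
    (h : ∀ s, cyclicWord ι τ (y - 1 - s) = letterT (cyclicWord ι τ (y + s))) :
    RealEigenvaluedS ι τ := by
  intro n _ A hA μ hμ
  have heval : evalWordS ι τ A =
      ((List.range k).map fun j : ℕ => realLetter A (cyclicWord ι τ j)).prod :=
    congrArg List.prod (map_finRange_eq_map_range ι τ (realLetter A))
  rw [heval, ← charpoly_prod_map_range_add _ (fun j => by simp) y.val] at hμ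
  refine Matrix.IsHermitian.im_eq_zero_of_isRoot_map_charpoly ?_ hμ
  rw [Matrix.IsHermitian, Matrix.conjTranspose_eq_transpose_of_trivial]
  refine isSymm_prod_map_range _ fun j hj => ?_
  obtain ⟨m, hm⟩ : ∃ m, k = j + m + 1 := ⟨k - 1 - j, by omega⟩
  have hm0 : (j : ZMod k) + m + 1 = 0 := by
    rw [← ZMod.natCast_self k]
    exact_mod_cast congrArg _ hm.symm
  push_cast
  rw [ZMod.natCast_zmod_val, ← realLetter_letterT A (fun hp => hA _ hp), ← h,
    show k - 1 - j = m by omega]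
  congr 2
  linear_combination -hm0

end Sufficiency

section Necessity

variable {k ℓ : ℕ}

/-- The assignment on the cycle `ZMod k` that reads the word `w` along the cycle, with phase `u` on
each edge. -/
noncomputable def phaseAssignment (w : ZMod k → Fin ℓ × SymExp) (u : ℂ) (m : Fin ℓ) :
    Matrix (ZMod k) (ZMod k) ℂ :=
  fun x y => (if y = x + 1 ∧ (w x).1 = m ∧ (w x).2 ≠ SymExp.tr then u else 0) +
    if y = x - 1 ∧ (w (x - 1)).1 = m ∧ (w (x - 1)).2 ≠ SymExp.one then u⁻¹ else 0

theorem phaseAssignment_conjTranspose (w : ZMod k → Fin ℓ × SymExp) {u : ℂ} (hu : star u = u⁻¹)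
    (m : Fin ℓ) (x y : ZMod k) :
    (phaseAssignment w u m)ᴴ x y =
      (if y = x + 1 ∧ (w x).1 = m ∧ (w x).2 ≠ SymExp.one then u else 0) +
        if y = x - 1 ∧ (w (x - 1)).1 = m ∧ (w (x - 1)).2 ≠ SymExp.tr then u⁻¹ else 0 := by
  have hu' : star u⁻¹ = u := by rw [← hu, star_star]
  have h1 : (x = y + 1 ∧ (w y).1 = m ∧ (w y).2 ≠ SymExp.tr) ↔
      (y = x - 1 ∧ (w (x - 1)).1 = m ∧ (w (x - 1)).2 ≠ SymExp.tr) := by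
    rw [eq_sub_iff_add_eq, eq_comm (a := x)]
    refine and_congr_right fun h => ?_
    rw [← h, add_sub_cancel_right]
  have h2 : (x = y - 1 ∧ (w (y - 1)).1 = m ∧ (w (y - 1)).2 ≠ SymExp.one) ↔
      (y = x + 1 ∧ (w x).1 = m ∧ (w x).2 ≠ SymExp.one) := by
    rw [eq_sub_iff_add_eq, eq_comm (a := y)]
    refine and_congr_right fun h => ?_
    rw [← h, add_sub_cancel_right]
  simp only [Matrix.conjTranspose_apply, phaseAssignment, star_add, apply_ite star, hu, hu',
    star_zero, h1, h2]
  exact add_comm _ _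

theorem phaseAssignment_isHermitian (w : ZMod k → Fin ℓ × SymExp) {u : ℂ} (hu : star u = u⁻¹)
    (m : Fin ℓ) (hm : ∀ x, (w x).1 = m → (w x).2 = SymExp.sym) :
    (phaseAssignment w u m)ᴴ = phaseAssignment w u m := by
  ext x y
  have hne : ∀ t ≠ SymExp.sym, ∀ x,
      ((w x).1 = m ∧ (w x).2 ≠ t) ↔ (w x).1 = m := fun t ht x =>
    and_iff_left_of_imp fun h => by rw [hm x h]; exact ht.symm
  rw [phaseAssignment_conjTranspose w hu, phaseAssignment]
  simp only [hne SymExp.one (by decide), hne SymExp.tr (by decide)]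

theorem complexLetter_phaseAssignment (w : ZMod k → Fin ℓ × SymExp)
    (hw : ∀ e e', (w e).2 = SymExp.sym → (w e').1 = (w e).1 → (w e').2 = SymExp.sym)
    {u : ℂ} (hu : star u = u⁻¹) (e : ZMod k) :
    complexLetter (phaseAssignment w u) (w e) = stepMatrix w letterT u (w e) := by
  have key : ∀ x, ((w e).2 ≠ SymExp.tr →
        ((w x).1 = (w e).1 ∧ (w x).2 ≠ SymExp.tr ↔ w x = w e) ∧
        ((w x).1 = (w e).1 ∧ (w x).2 ≠ SymExp.one ↔ w x = letterT (w e))) ∧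
      ((w e).2 = SymExp.tr →
        ((w x).1 = (w e).1 ∧ (w x).2 ≠ SymExp.one ↔ w x = w e) ∧
        ((w x).1 = (w e).1 ∧ (w x).2 ≠ SymExp.tr ↔ w x = letterT (w e))) := by
    intro x
    have h1 := hw e x
    have h2 := hw x e
    generalize w x = p at *
    generalize w e = q at *
    obtain ⟨m, t⟩ := p
    obtain ⟨m', t'⟩ := q
    cases t <;> cases t' <;> simp_all [letterT, SymExp.formalT, eq_comm]
  ext x y
  unfold complexLetter
  split_ifs with h
  · rw [phaseAssignment_conjTranspose w hu, stepMatrix]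
    simp only [((key _).2 h).1, ((key _).2 h).2]
  · rw [phaseAssignment, stepMatrix]
    simp only [((key _).1 h).1, ((key _).1 h).2]

theorem exists_phase (hk : k ≠ 0) : ∃ u : ℂ, u ≠ 0 ∧ star u = u⁻¹ ∧ u ^ k = Complex.I := by
  refine ⟨Complex.exp ((Real.pi / 2 / k : ℝ) * Complex.I), Complex.exp_ne_zero _, ?_, ?_⟩
  · rw [← Complex.exp_neg, Complex.star_def, ← Complex.exp_conj, map_mul, Complex.conj_ofReal,
      Complex.conj_I, mul_neg]
  · have hk' : (k : ℂ) ≠ 0 := by exact_mod_cast hk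
    have harg : (k : ℂ) * ((Real.pi / 2 / k : ℝ) * Complex.I) = Real.pi / 2 * Complex.I := by
      push_cast
      field_simp
    rw [← Complex.exp_nat_mul, harg, Complex.exp_pi_div_two_mul_I]

theorem RealEigenvaluedS.exists_reflection [NeZero k] {ι : Fin k → Fin ℓ} {τ : Fin k → SymExp}
    (hcons : ∀ i i' : Fin k, τ i = SymExp.sym → ι i' = ι i → τ i' = SymExp.sym)
    (h : RealEigenvaluedS ι τ) :
    ∃ y : ZMod k, ∀ s, cyclicWord ι τ (y - 1 - s) = letterT (cyclicWord ι τ (y + s)) := by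
  obtain ⟨u, hu0, hu, huk⟩ := exists_phase (NeZero.ne k)
  have hw : ∀ e e', (cyclicWord ι τ e).2 = SymExp.sym →
      (cyclicWord ι τ e').1 = (cyclicWord ι τ e).1 → (cyclicWord ι τ e').2 = SymExp.sym :=
    fun e e' => hcons _ _
  refine exists_reflection_of_stepMatrix _ letterT hu0 huk fun v hv μ hμ => ?_
  refine h.im_eq_zero_of_mulVec (phaseAssignment (cyclicWord ι τ) u) (fun i hi => ?_) hv ?_
  · exact phaseAssignment_isHermitian _ hu _ fun x hx => hcons _ _ hi hx
  · rw [map_finRange_eq_map_range ι τ (complexLetter _), ← hμ, List.map_map]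
    congr 3
    ext1 j
    exact complexLetter_phaseAssignment _ hw hu _

end Necessity

/-- A symbolic matrix product including symmetric variables is real-eigenvalued
if and only if it is symmetric, or it is of the form `L·Lᵀ·X^sym` up to cyclic shift. -/
theorem realEigenvaluedS_iff {k ℓ : ℕ} (hk : 0 < k)
    (ι : Fin k → Fin ℓ) (τ : Fin k → SymExp)
    (hcons : ∀ i i' : Fin k, τ i = SymExp.sym → ι i' = ι i → τ i' = SymExp.sym) :
    RealEigenvaluedS ι τ ↔ SymmetricWordS hk ι τ ∨ SymPlusVarWord hk ι τ := by
  have : NeZero k := ⟨hk.ne'⟩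
  rw [symmetric_or_symPlusVar_iff_exists_reflection]
  exact ⟨fun h => h.exists_reflection hcons,
    fun ⟨y, hy⟩ => realEigenvaluedS_of_reflection ι τ y hy⟩
end

section
/- Let H be an infinite-dimensional complex Hilbert space, and let P be a symbolic operator product of degree k ≥ 1 with ℓ variables whose factors are variables or their adjoints. Then P is real-eigenvalued over H (for every assignment of bounded linear operators H → H to the variables, every eigenvalue of the composed operator is real) if and only if P is self-adjoint, i.e. k is even and some cyclic shift of the word P can be written as L·L*. -/
/-- Evaluation of the symbolic operator product
`P = X_{ι 0}^{τ 0} ⋯ X_{ι (k-1)}^{τ (k-1)}` on an assignment `A` of bounded linear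
operators on a complex Hilbert space `H`; exponent `false` is the operator itself,
`true` its adjoint. The product is composition, first factor applied last. -/
noncomputable def evalOpWord {H : Type} [NormedAddCommGroup H] [InnerProductSpace ℂ H]
    [CompleteSpace H] {k ℓ : ℕ} (ι : Fin k → Fin ℓ) (τ : Fin k → Bool)
    (A : Fin ℓ → (H →L[ℂ] H)) : H →L[ℂ] H :=
  ((List.finRange k).map
    (fun i => if τ i then ContinuousLinearMap.adjoint (A (ι i)) else A (ι i))).prod

/-- `P` is self-adjoint: `k` is even and some cyclic shift of the word can
be written as `L·L*`, where `L*` is the reversal of `L` with every exponent flipped. -/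
def SelfAdjointOpWord {k ℓ : ℕ} (hk : 0 < k) (ι : Fin k → Fin ℓ) (τ : Fin k → Bool) : Prop :=
  k % 2 = 0 ∧ ∃ j : ℕ, j < k ∧ ∀ s : ℕ, s < k / 2 →
    ι ⟨(j + 1 + s) % k, Nat.mod_lt _ hk⟩ = ι ⟨(j + k - s) % k, Nat.mod_lt _ hk⟩ ∧
    τ ⟨(j + 1 + s) % k, Nat.mod_lt _ hk⟩ ≠ τ ⟨(j + k - s) % k, Nat.mod_lt _ hk⟩

section ListProducts

variable {R : Type*} [Semiring R]

theorem prod_ofFn_sum {α : Type*} [Fintype α] {n : ℕ} (f : Fin n → α → R) :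
    (List.ofFn fun i => ∑ a, f i a).prod =
      ∑ e : Fin n → α, (List.ofFn fun i => f i (e i)).prod := by
  induction n with
  | zero => simp
  | succ n ih =>
    simp only [List.ofFn_succ, List.prod_cons]
    rw [ih, Finset.sum_mul_sum, ← Fintype.sum_prod_type',
      ← (Fin.consEquiv fun _ => α).sum_comp]
    simp [Fin.consEquiv]

theorem prod_ofFn_smul {S : Type*} [CommSemiring S] [Algebra S R] {n : ℕ}
    (c : Fin n → S) (f : Fin n → R) :
    (List.ofFn fun i => c i • f i).prod = (∏ i, c i) • (List.ofFn f).prod := by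
  induction n with
  | zero => simp
  | succ n ih =>
    simp only [List.ofFn_succ, List.prod_cons]
    rw [ih, Fin.prod_univ_succ, smul_mul_smul_comm]

theorem star_prod_eq_prod_reverse [StarRing R] (l : List R) :
    star l.prod = (l.map star).reverse.prod := by
  induction l with
  | nil => simp
  | cons a l ih => simp [ih]

end ListProducts

/-- An entry of a product of natural-number matrices is nonzero exactly when there is a walk
between its indices along nonzero entries of the factors. -/
theorem prod_ofFn_apply_ne_zero_iff {V : Type*} [Fintype V] [DecidableEq V] {n : ℕ}
    (M : Fin n → Matrix V V ℕ) (u v : V) :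
    (List.ofFn M).prod u v ≠ 0 ↔ ∃ x : Fin (n + 1) → V, x 0 = u ∧ x (Fin.last n) = v ∧
      ∀ i : Fin n, M i (x i.castSucc) (x i.succ) ≠ 0 := by
  induction n generalizing u with
  | zero =>
    simp only [List.ofFn_zero, List.prod_nil, Matrix.one_apply, ne_eq, ite_eq_right_iff,
      one_ne_zero, imp_false, not_not]
    constructor
    · rintro rfl
      exact ⟨fun _ => u, rfl, rfl, fun i => i.elim0⟩
    · rintro ⟨x, rfl, rfl, -⟩
      rfl
  | succ n ih =>
    simp only [List.ofFn_succ, List.prod_cons, Matrix.mul_apply, ne_eq, Finset.sum_eq_zero_iff,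
      Finset.mem_univ, true_implies, mul_eq_zero, not_forall, not_or]
    constructor
    · rintro ⟨w, hw, h⟩
      obtain ⟨x, rfl, rfl, hx⟩ := (ih _ w).1 h
      refine ⟨Fin.cons u x, rfl, by simp [← Fin.succ_last], fun i => ?_⟩
      refine Fin.cases (by simpa using hw) (fun i => ?_) i
      simpa [← Fin.succ_castSucc] using hx i
    · rintro ⟨x, rfl, rfl, hx⟩
      exact ⟨x 1, by simpa using hx 0, (ih _ _).2 ⟨fun i => x i.succ, by simp, by simp,
        fun i => by simpa [← Fin.succ_castSucc] using hx i.succ⟩⟩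

section CubeRoots

/-- The complex number itself, or its conjugate when the flag is `false`. -/
def conjUnless (b : Bool) (w : ℂ) : ℂ := if b then w else star w

/-- The three complex cube roots of unity. -/
noncomputable def cubeRoot : Fin 3 → ℂ :=
  ![1, ⟨-1 / 2, √3 / 2⟩, ⟨-1 / 2, -(√3 / 2)⟩]

theorem sum_conjUnless_cubeRoot (b : Bool) : ∑ a, conjUnless b (cubeRoot a) = 0 := by
  cases b <;> apply Complex.ext <;> simp [conjUnless, cubeRoot, Fin.sum_univ_three] <;> norm_num

theorem sum_conjUnless_mul_conjUnless_cubeRoot (b c : Bool) :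
    ∑ a, conjUnless b (cubeRoot a) * conjUnless c (cubeRoot a) = if b ≠ c then 3 else 0 := by
  have h : √3 * √3 = 3 := Real.mul_self_sqrt (by norm_num)
  cases b <;> cases c <;> apply Complex.ext <;>
    simp [conjUnless, cubeRoot, Fin.sum_univ_three] <;> ring_nf <;> norm_num

theorem sum_monomial_cubeRoot {k : ℕ} (e : Fin k → Fin k) (s : Fin k → Bool) (b : Bool) :
    ∑ m : Fin k → Fin 3, (∏ i, conjUnless (s i) (cubeRoot (m (e i)))) *
        ∏ p, conjUnless b (cubeRoot (m p)) =
      ((if Function.Bijective e ∧ ∀ i, s i ≠ b then 3 ^ k else 0 : ℕ) : ℂ) := by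
  have key : ∀ m : Fin k → Fin 3, (∏ i, conjUnless (s i) (cubeRoot (m (e i)))) *
      ∏ p, conjUnless b (cubeRoot (m p)) =
      ∏ p, (∏ i with e i = p, conjUnless (s i) (cubeRoot (m p))) *
        conjUnless b (cubeRoot (m p)) := by
    intro m
    rw [Finset.prod_mul_distrib, ← Finset.prod_fiberwise _ e]
    congr 1
    refine Finset.prod_congr rfl fun p _ => Finset.prod_congr rfl fun i hi => ?_
    rw [(Finset.mem_filter.1 hi).2]
  simp_rw [key]
  rw [← Fintype.prod_sum fun p a => (∏ i with e i = p, conjUnless (s i) (cubeRoot a)) *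
    conjUnless b (cubeRoot a)]
  by_cases he : Function.Bijective e
  · rw [← he.prod_comp]
    have hf : ∀ i, ({i' | e i' = e i} : Finset (Fin k)) = {i} := fun i => by
      ext i'
      simp [he.1.eq_iff]
    simp only [hf, Finset.prod_singleton, sum_conjUnless_mul_conjUnless_cubeRoot]
    by_cases hs : ∀ i, s i ≠ b
    · rw [if_pos ⟨he, hs⟩]
      simp only [if_pos (hs _), Finset.prod_const, Finset.card_univ, Fintype.card_fin]
      norm_cast
    · rw [if_neg fun h => hs h.2]
      push Not at hs
      obtain ⟨i, hi⟩ := hs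
      rw [Nat.cast_zero]
      exact Finset.prod_eq_zero (Finset.mem_univ i) (by simp [hi])
  · rw [if_neg fun h => he h.1]
    have hs : ¬ Function.Surjective e := fun h => he (Finite.surjective_iff_bijective.1 h)
    simp only [Function.Surjective, not_forall, not_exists] at hs
    obtain ⟨p, hp⟩ := hs
    rw [Nat.cast_zero]
    refine Finset.prod_eq_zero (Finset.mem_univ p) ?_
    simp [hp, sum_conjUnless_cubeRoot]

end CubeRoots

section CycleMatrices

variable {k ℓ : ℕ} (ι : Fin k → Fin ℓ) (τ : Fin k → Bool)

/-- The successor on the vertices of the `k`-cycle. -/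
def cycleSucc {k : ℕ} (p : Fin k) : Fin k := ⟨(p + 1) % k, Nat.mod_lt _ p.pos⟩

/-- The matrix assigned to the variable `j`: the sum of the edges of the `k`-cycle carrying the
letter `j`, each with its weight, and reversed when the letter is starred. -/
noncomputable def cycleMatrix (z : Fin k → ℂ) (j : Fin ℓ) : Matrix (Fin k) (Fin k) ℂ :=
  ∑ p, if ι p = j then
    if τ p then Matrix.single (cycleSucc p) p (star (z p)) else Matrix.single p (cycleSucc p) (z p)
  else 0

/-- The matrix unit by which the `i`-th letter of the word crosses the `p`-th edge of the
`k`-cycle. -/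
def crossing (i p : Fin k) : Matrix (Fin k) (Fin k) ℕ :=
  if ι p = ι i then
    if τ p = τ i then Matrix.single p (cycleSucc p) 1 else Matrix.single (cycleSucc p) p 1
  else 0

/-- The matrix value of the `i`-th letter. -/
noncomputable def cycleLetter (z : Fin k → ℂ) (i : Fin k) : Matrix (Fin k) (Fin k) ℂ :=
  if τ i then star (cycleMatrix ι τ z (ι i)) else cycleMatrix ι τ z (ι i)

theorem cycleLetter_eq_sum (z : Fin k → ℂ) (i : Fin k) :
    cycleLetter ι τ z i = ∑ p, conjUnless (τ p == τ i) (z p) •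
      (Nat.castRingHom ℂ).mapMatrix (crossing ι τ i p) := by
  have hmap : ∀ a b : Fin k, (Matrix.single a b (1 : ℕ)).map (Nat.cast : ℕ → ℂ) =
      Matrix.single a b 1 := fun a b => by
    ext c d
    simp [Matrix.single_apply]
  unfold cycleLetter cycleMatrix crossing
  cases hi : τ i
  · simp only [Bool.false_eq_true, if_false]
    refine Finset.sum_congr rfl fun p _ => ?_
    by_cases hp : ι p = ι i <;> cases hq : τ p <;>
      simp [hp, conjUnless, hmap]
  · simp only [if_true, star_sum]
    refine Finset.sum_congr rfl fun p _ => ?_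
    by_cases hp : ι p = ι i <;> cases hq : τ p <;>
      simp [hp, conjUnless, Matrix.star_eq_conjTranspose, Matrix.conjTranspose_single,
        hmap]

theorem trace_prod_cycleLetter (z : Fin k → ℂ) :
    (List.ofFn (cycleLetter ι τ z)).prod.trace =
      ∑ e : Fin k → Fin k, (∏ i, conjUnless (τ (e i) == τ i) (z (e i))) *
        (((List.ofFn fun i => crossing ι τ i (e i)).prod.trace : ℕ) : ℂ) := by
  have h : cycleLetter ι τ z = fun i => ∑ p, conjUnless (τ p == τ i) (z p) •
      (Nat.castRingHom ℂ).mapMatrix (crossing ι τ i p) :=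
    funext (cycleLetter_eq_sum ι τ z)
  rw [h, prod_ofFn_sum, Matrix.trace_sum]
  refine Finset.sum_congr rfl fun e _ => ?_
  rw [prod_ofFn_smul, Matrix.trace_smul, smul_eq_mul]
  congr 1
  rw [show (List.ofFn fun i => (Nat.castRingHom ℂ).mapMatrix (crossing ι τ i (e i))) =
      (List.ofFn fun i => crossing ι τ i (e i)).map (Nat.castRingHom ℂ).mapMatrix by
    simp [List.map_ofFn, Function.comp_def], ← map_list_prod]
  simp [Matrix.trace]

/-- The Fourier coefficient of the trace of the word at the character picking out the monomial
in which each edge of the cycle is used once, in the same direction. -/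
theorem sum_trace_prod_cycleLetter (b : Bool) :
    ∑ m : Fin k → Fin 3, (List.ofFn (cycleLetter ι τ fun p => cubeRoot (m p))).prod.trace *
        ∏ p, conjUnless b (cubeRoot (m p)) =
      ((∑ e : Fin k → Fin k,
        (if Function.Bijective e ∧ ∀ i, (τ (e i) == τ i) ≠ b then 3 ^ k else 0) *
          (List.ofFn fun i => crossing ι τ i (e i)).prod.trace : ℕ) : ℂ) := by
  simp_rw [trace_prod_cycleLetter, Finset.sum_mul]
  rw [Finset.sum_comm, Nat.cast_sum]
  refine Finset.sum_congr rfl fun e _ => ?_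
  rw [Nat.cast_mul, ← sum_monomial_cubeRoot e (fun i => τ (e i) == τ i) b, Finset.sum_mul]
  exact Finset.sum_congr rfl fun m _ => by ring

theorem trace_prod_crossing_self_ne_zero (hk : 0 < k) :
    (List.ofFn fun i => crossing ι τ i i).prod.trace ≠ 0 := by
  intro h
  have h0 := Finset.sum_eq_zero_iff.1 h ⟨0, hk⟩ (Finset.mem_univ _)
  refine (prod_ofFn_apply_ne_zero_iff _ _ _).2
    ⟨fun i => ⟨i % k, Nat.mod_lt _ hk⟩, by simp, by simp, fun i => ?_⟩ h0
  have hi : (⟨i % k, Nat.mod_lt _ hk⟩ : Fin k) = i := Fin.ext (Nat.mod_eq_of_lt i.2)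
  simp [crossing, hi, cycleSucc]

theorem selfAdjointOpWord_of_reversal (hk : 0 < k) (c : ℕ)
    (h : ∀ p q : Fin k, (p + q + 1) ≡ c [MOD k] → ι p = ι q ∧ τ p ≠ τ q) :
    SelfAdjointOpWord hk ι τ := by
  have hne : ∀ n : ℕ, ¬ (2 * n + 1 ≡ c [MOD k]) := fun n hn => by
    refine (h ⟨n % k, Nat.mod_lt _ hk⟩ ⟨n % k, Nat.mod_lt _ hk⟩ ?_).2 rfl
    refine Nat.ModEq.trans ?_ hn
    have := Nat.mod_modEq n k
    simpa [two_mul] using (this.add this).add_right 1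
  have hc : c % 2 = 0 := by
    by_contra hc
    exact hne (c / 2) (by rw [show 2 * (c / 2) + 1 = c by omega])
  have hk2 : k % 2 = 0 := by
    by_contra hk2
    refine hne ((c + k) / 2) ?_
    rw [show 2 * ((c + k) / 2) + 1 = c + k by omega]
    simp [Nat.ModEq]
  refine ⟨hk2, (c / 2 + k - 1) % k, Nat.mod_lt _ hk, fun s hs => h _ _ ?_⟩
  generalize hj : (c / 2 + k - 1) % k = j
  have hj' : j ≡ c / 2 + k - 1 [MOD k] := hj ▸ Nat.mod_modEq _ _
  calc (j + 1 + s) % k + (j + k - s) % k + 1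
      ≡ (j + 1 + s) + (j + k - s) + 1 [MOD k] :=
        ((Nat.mod_modEq _ _).add (Nat.mod_modEq _ _)).add_right 1
    _ = j + j + (k + 2) := by omega
    _ ≡ (c / 2 + k - 1) + (c / 2 + k - 1) + (k + 2) [MOD k] := (hj'.add hj').add_right _
    _ = c + k * 3 := by omega
    _ ≡ c [MOD k] := by simp [Nat.ModEq]

theorem selfAdjointOpWord_of_trace_ne_zero (hk : 0 < k) (e : Fin k → Fin k)
    (he : ∀ i, τ (e i) ≠ τ i)
    (h : (List.ofFn fun i => crossing ι τ i (e i)).prod.trace ≠ 0) :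
    SelfAdjointOpWord hk ι τ := by
  obtain ⟨u, -, hu⟩ := Finset.exists_ne_zero_of_sum_ne_zero h
  obtain ⟨x, hx0, -, hx⟩ := (prod_ofFn_apply_ne_zero_iff _ _ _).1 hu
  have hstep : ∀ i : Fin k, ι (x i.succ) = ι i ∧ τ (x i.succ) ≠ τ i ∧
      x i.castSucc = cycleSucc (x i.succ) := by
    intro i
    have hi := hx i
    unfold crossing at hi
    rw [if_neg (he i)] at hi
    split_ifs at hi with hι
    · rw [Matrix.single_apply] at hi
      simp only [ne_eq, ite_eq_right_iff, one_ne_zero, imp_false, not_not] at hi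
      rw [← hi.1, ← hi.2]
      exact ⟨hι, he i, rfl⟩
    · simp at hi
  have hmod : ∀ i : Fin (k + 1), (x i : ℕ) + i ≡ u [MOD k] := by
    intro i
    induction i using Fin.induction with
    | zero => simp [hx0, Nat.ModEq.refl]
    | succ i ih =>
      refine Nat.ModEq.trans ?_ ih
      rw [(hstep i).2.2]
      have := (Nat.mod_modEq (x i.succ + 1) k).symm.add_right i
      rw [add_right_comm, add_assoc] at this
      exact this
  refine selfAdjointOpWord_of_reversal ι τ hk u fun p q hpq => ?_
  have hq : x q.succ = p := by
    have h1 := (hmod q.succ).trans hpq.symm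
    rw [Fin.val_succ, add_assoc] at h1
    exact Fin.ext (Nat.ModEq.eq_of_lt_of_lt (Nat.ModEq.add_right_cancel' _ h1) (x q.succ).2 p.2)
  rw [← hq]
  exact ⟨(hstep q).1, (hstep q).2.1⟩

theorem selfAdjointOpWord_of_trace_real (hk : 0 < k)
    (h : ∀ z : Fin k → ℂ, (List.ofFn (cycleLetter ι τ z)).prod.trace.im = 0) :
    SelfAdjointOpWord hk ι τ := by
  have hreal : ∀ z : Fin k → ℂ, star (List.ofFn (cycleLetter ι τ z)).prod.trace =
      (List.ofFn (cycleLetter ι τ z)).prod.trace := fun z => Complex.conj_eq_iff_im.2 (h z)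
  have hflip : ∀ w, star (conjUnless false w) = conjUnless true w := fun w => by simp [conjUnless]
  have hconj : ∑ m : Fin k → Fin 3,
        (List.ofFn (cycleLetter ι τ fun p => cubeRoot (m p))).prod.trace *
        ∏ p, conjUnless true (cubeRoot (m p)) =
      star (∑ m : Fin k → Fin 3,
        (List.ofFn (cycleLetter ι τ fun p => cubeRoot (m p))).prod.trace *
        ∏ p, conjUnless false (cubeRoot (m p))) := by
    simp only [star_sum, star_mul', star_prod, hreal, hflip]
  rw [sum_trace_prod_cycleLetter, sum_trace_prod_cycleLetter, star_natCast] at hconj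
  have hpos : (∑ e : Fin k → Fin k,
      (if Function.Bijective e ∧ ∀ i, (τ (e i) == τ i) ≠ false then 3 ^ k else 0) *
        (List.ofFn fun i => crossing ι τ i (e i)).prod.trace) ≠ 0 := by
    intro h0
    have := Finset.sum_eq_zero_iff.1 h0 id (Finset.mem_univ _)
    rw [if_pos ⟨Function.bijective_id, by simp⟩] at this
    exact trace_prod_crossing_self_ne_zero ι τ hk (by simpa using this)
  rw [← Nat.cast_injective hconj] at hpos
  obtain ⟨e, -, he⟩ := Finset.exists_ne_zero_of_sum_ne_zero hpos
  split_ifs at he with hcond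
  · exact selfAdjointOpWord_of_trace_ne_zero ι τ hk e (fun i => by simpa using hcond.2 i)
      (right_ne_zero_of_mul he)
  · simp at he

end CycleMatrices

theorem trace_im_eq_zero_of_eigenvalues_real {n : ℕ} (B : Matrix (Fin n) (Fin n) ℂ)
    (h : ∀ (μ : ℂ) (y : Fin n → ℂ), y ≠ 0 → B.mulVec y = μ • y → μ.im = 0) :
    B.trace.im = 0 := by
  have hroots : ∀ μ ∈ B.charpoly.roots, μ.im = 0 := by
    intro μ hμ
    have hroot := Polynomial.isRoot_of_mem_roots hμ
    rw [← Matrix.charpoly_toLin', ← Module.End.hasEigenvalue_iff_isRoot_charpoly] at hroot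
    obtain ⟨y, hy⟩ := hroot.exists_hasEigenvector
    exact h μ y hy.2 (by simpa using hy.apply_eq_smul)
  rw [Matrix.trace_eq_sum_roots_charpoly]
  change Complex.imAddGroupHom _ = 0
  rw [map_multiset_sum]
  refine Multiset.sum_eq_zero fun t ht => ?_
  obtain ⟨μ, hμ, rfl⟩ := Multiset.mem_map.1 ht
  exact hroots μ hμ

section Operators

variable {H : Type} [NormedAddCommGroup H] [InnerProductSpace ℂ H]

theorem exists_linearIsometry_euclideanSpace (hinf : ¬ FiniteDimensional ℂ H) (n : ℕ) :
    Nonempty (EuclideanSpace ℂ (Fin n) →ₗᵢ[ℂ] H) := by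
  have hrank : (n : Cardinal) ≤ Module.rank ℂ H := by
    refine (Cardinal.natCast_lt_aleph0 (n := n)).le.trans (not_lt.1 fun h => hinf ?_)
    exact Module.rank_lt_aleph0_iff.1 h
  obtain ⟨s, hs, hli⟩ := exists_finset_linearIndependent_of_le_rank hrank
  have hfin : Module.finrank ℂ (Submodule.span ℂ (s : Set H)) = n :=
    (finrank_span_finset_eq_card hli).trans hs
  let b := (stdOrthonormalBasis ℂ (Submodule.span ℂ (s : Set H))).reindex (finCongr hfin)
  exact ⟨(Submodule.span ℂ (s : Set H)).subtypeₗᵢ.comp b.repr.symm.toLinearIsometry⟩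

theorem exists_eigenvector_prod_rotate (l : List (H →L[ℂ] H)) (n : ℕ) (hn : n ≤ l.length) {μ : ℂ}
    (hμ : μ ≠ 0) {x : H} (hx : x ≠ 0) (h : l.prod x = μ • x) :
    ∃ y : H, y ≠ 0 ∧ (l.rotate n).prod y = μ • y := by
  rw [← List.take_append_drop n l, List.prod_append, mul_apply_eq_comp] at h
  refine ⟨(l.drop n).prod x, fun h0 => ?_, ?_⟩
  · rw [h0, map_zero] at h
    exact smul_ne_zero hμ hx h.symm
  · rw [List.rotate_eq_drop_append_take hn, List.prod_append, mul_apply_eq_comp, h,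
      map_smul]

variable [CompleteSpace H]

theorem exists_operators_of_matrices (hinf : ¬ FiniteDimensional ℂ H) {k ℓ : ℕ}
    (ι : Fin k → Fin ℓ) (τ : Fin k → Bool) {n : ℕ} (B : Fin ℓ → Matrix (Fin n) (Fin n) ℂ)
    {μ : ℂ} {y : Fin n → ℂ} (hy : y ≠ 0)
    (hμ : (List.ofFn fun i => if τ i then star (B (ι i)) else B (ι i)).prod.mulVec y = μ • y) :
    ∃ A : Fin ℓ → (H →L[ℂ] H), ∃ x : H, x ≠ 0 ∧ evalOpWord ι τ A x = μ • x := by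
  obtain ⟨V⟩ := exists_linearIsometry_euclideanSpace hinf n
  let W := V.toContinuousLinearMap
  let T : Matrix (Fin n) (Fin n) ℂ → (H →L[ℂ] H) := fun C =>
    W ∘L Matrix.toEuclideanCLM (𝕜 := ℂ) C ∘L ContinuousLinearMap.adjoint W
  have hT : ∀ C v, T C (V v) = V (Matrix.toEuclideanCLM (𝕜 := ℂ) C v) := fun C v => by
    have := DFunLike.congr_fun V.adjoint_comp_self v
    simp only [ContinuousLinearMap.comp_apply, one_apply_eq_self] at this
    change V (Matrix.toEuclideanCLM (𝕜 := ℂ) C (ContinuousLinearMap.adjoint W (W v))) = _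
    exact congrArg (fun t => V (Matrix.toEuclideanCLM (𝕜 := ℂ) C t)) this
  have hTstar : ∀ C, ContinuousLinearMap.adjoint (T C) = T (star C) := fun C => by
    simp only [T, ContinuousLinearMap.adjoint_comp, ContinuousLinearMap.adjoint_adjoint, map_star,
      ContinuousLinearMap.star_eq_adjoint, ContinuousLinearMap.comp_assoc]
  have hlist : ∀ (l : List (Matrix (Fin n) (Fin n) ℂ)) (v : EuclideanSpace ℂ (Fin n)),
      (l.map T).prod (V v) = V (Matrix.toEuclideanCLM (𝕜 := ℂ) l.prod v) := by
    intro l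
    induction l with
    | nil => simp
    | cons C l ih => intro v; simp [ih, hT]
  refine ⟨fun j => T (B j), V (WithLp.toLp 2 y), ?_, ?_⟩
  · rw [← norm_ne_zero_iff, V.norm_map, norm_ne_zero_iff]
    simpa using hy
  · have heval : evalOpWord ι τ (fun j => T (B j)) =
        ((List.ofFn fun i => if τ i then star (B (ι i)) else B (ι i)).map T).prod := by
      rw [evalOpWord, ← List.ofFn_eq_map, List.map_ofFn]
      congr 2
      funext i
      cases hi : τ i <;> simp [hi, hTstar]
    rw [heval, hlist, ← map_smul]
    congr 1
    rw [Matrix.toEuclideanCLM_toLp, hμ, WithLp.toLp_smul]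

theorem im_eq_zero_of_mul_adjoint_apply (L : H →L[ℂ] H) {μ : ℂ} {y : H} (hy : y ≠ 0)
    (h : (L * star L) y = μ • y) : μ.im = 0 := by
  have hsymm := (IsSelfAdjoint.mul_star_self L).isSymmetric
  exact Complex.conj_eq_iff_im.1 (hsymm.conj_eigenvalue_eq_self
    (Module.End.hasEigenvalue_of_hasEigenvector (x := y) ⟨Module.End.mem_eigenspace_iff.2 h, hy⟩))

theorem prod_rotate_eq_mul_star {k ℓ : ℕ} (hk : 0 < k) (ι : Fin k → Fin ℓ) (τ : Fin k → Bool)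
    (A : Fin ℓ → (H →L[ℂ] H)) (hk2 : k % 2 = 0) (j : ℕ)
    (h : ∀ s : ℕ, s < k / 2 →
      ι ⟨(j + 1 + s) % k, Nat.mod_lt _ hk⟩ = ι ⟨(j + k - s) % k, Nat.mod_lt _ hk⟩ ∧
      τ ⟨(j + 1 + s) % k, Nat.mod_lt _ hk⟩ ≠ τ ⟨(j + k - s) % k, Nat.mod_lt _ hk⟩) :
    ∃ L : H →L[ℂ] H, ((List.ofFn fun i => if τ i then ContinuousLinearMap.adjoint (A (ι i))
      else A (ι i)).rotate (j + 1)).prod = L * star L := by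
  set l := (List.ofFn fun i => if τ i then ContinuousLinearMap.adjoint (A (ι i))
      else A (ι i)).rotate (j + 1) with hl
  have hlen : l.length = k := by simp [hl]
  refine ⟨(l.take (k / 2)).prod, ?_⟩
  rw [star_prod_eq_prod_reverse, ← List.prod_append]
  congr 1
  conv_lhs => rw [← List.take_append_drop (k / 2) l]
  congr 1
  refine List.ext_getElem (by simp [hlen]; omega) fun t ht₁ ht₂ => ?_
  have ht : t < k / 2 := by simp [hlen] at ht₂; omega
  have hs := h (k / 2 - 1 - t) (by omega)
  simp only [List.getElem_drop, List.getElem_reverse, List.getElem_map, List.getElem_take,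
    List.length_map, List.length_take, hl, List.getElem_rotate, List.getElem_ofFn,
    List.length_rotate, List.length_ofFn]
  have h1 : (⟨(k / 2 + t + (j + 1)) % k, Nat.mod_lt _ hk⟩ : Fin k) =
      ⟨(j + k - (k / 2 - 1 - t)) % k, Nat.mod_lt _ hk⟩ := by
    ext; simp only; congr 1; omega
  have h2 : (⟨(min (k / 2) k - 1 - t + (j + 1)) % k, Nat.mod_lt _ hk⟩ : Fin k) =
      ⟨(j + 1 + (k / 2 - 1 - t)) % k, Nat.mod_lt _ hk⟩ := by
    ext; simp only; congr 1; omega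
  simp only [h1, h2]
  rw [← hs.1]
  generalize τ ⟨(j + k - (k / 2 - 1 - t)) % k, _⟩ = a at hs ⊢
  generalize τ ⟨(j + 1 + (k / 2 - 1 - t)) % k, _⟩ = b at hs ⊢
  cases a <;> cases b <;> simp_all [ContinuousLinearMap.star_eq_adjoint]

end Operators

/-- For an infinite-dimensional complex Hilbert space `H`, a symbolic operator product
is real-eigenvalued over `H` (every eigenvalue of every evaluation is real) if and only
if it is self-adjoint. -/
theorem realEigenvaluedOp_iff_selfAdjoint {H : Type} [NormedAddCommGroup H]
    [InnerProductSpace ℂ H] [CompleteSpace H] (hinf : ¬ FiniteDimensional ℂ H)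
    {k ℓ : ℕ} (hk : 0 < k) (ι : Fin k → Fin ℓ) (τ : Fin k → Bool) :
    (∀ A : Fin ℓ → (H →L[ℂ] H), ∀ μ : ℂ,
        (∃ x : H, x ≠ 0 ∧ evalOpWord ι τ A x = μ • x) → μ.im = 0) ↔
      SelfAdjointOpWord hk ι τ := by
  constructor
  · intro h
    refine selfAdjointOpWord_of_trace_real ι τ hk fun z =>
      trace_im_eq_zero_of_eigenvalues_real _ fun μ y hy hμ => ?_
    obtain ⟨A, hA⟩ := exists_operators_of_matrices hinf ι τ (cycleMatrix ι τ z) hy hμ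
    exact h A μ hA
  · rintro ⟨hk2, j, hj, h⟩ A μ ⟨x, hx, hμ⟩
    by_cases hμ0 : μ = 0
    · simp [hμ0]
    rw [evalOpWord, ← List.ofFn_eq_map] at hμ
    obtain ⟨y, hy, hμy⟩ := exists_eigenvector_prod_rotate _ (j + 1) (by simpa using hj) hμ0 hx hμ
    obtain ⟨L, hL⟩ := prod_rotate_eq_mul_star hk ι τ A hk2 j h
    exact im_eq_zero_of_mul_adjoint_apply L hy (hL ▸ hμy)
end
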